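/- In a stable theory, if c is a tuple of imaginary elements algebraic over ∅, and p^j(x^j; y^j, c) ⟶ q^j(x^j; y^j, c) for j = 1, 2, where all four types are stationary, then p¹(x¹;y¹,c) ⊗ p²(x²;y²,c) ⟶ q¹(x¹;y¹,c) ⊗ q²(x²;y²,c). -/

import Mathlib

open FirstOrder FirstOrder.Language Set

universe u v w

namespace Equationality

variable {L : FirstOrder.Language.{u, v}}

section Struc
variable {M : Type w} [L.Structure M]

/-- The instance of the formula `φ(x; y)` at the parameter tuple `b`. -/
def instSet {α β : Type*} (φ : L.Formula (α ⊕ β)) (b : β → M) : Set (α → M) :=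
  {a | φ.Realize (Sum.elim a b)}

/-- A sequence of `γ`-tuples indexed by a linear order is indiscernible if any two strictly
increasing finite subsequences satisfy the same formulas. -/
def IsIndiscernible {I : Type*} [LinearOrder I] {γ : Type*} (a : I → γ → M) : Prop :=
  ∀ (n : ℕ) (i j : Fin n → I), StrictMono i → StrictMono j →
    ∀ φ : L.Formula (Fin n × γ),
      φ.Realize (fun p => a (i p.1) p.2) ↔ φ.Realize (fun p => a (j p.1) p.2)

/-- The complete type of a tuple over `∅`, as the set of formulas it realizes. -/
def typeOf {γ : Type*} (a : γ → M) : Set (L.Formula γ) := {φ | φ.Realize a}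

end Struc

variable (T : L.Theory)

/-- `φ(x; y)` is an equation for `T`: in every model of `T`, the family of finite
intersections of instances of `φ` has the descending chain condition. -/
def IsEquation {α β : Type*} (φ : L.Formula (α ⊕ β)) : Prop :=
  ∀ (M : Theory.ModelType.{u, v, max u v} T) (B : ℕ → Finset (β → M)),
    (Antitone fun n => ⋂ b ∈ B n, instSet φ b) →
    ∃ N, ∀ n, N ≤ n → (⋂ b ∈ B n, instSet φ b) = ⋂ b ∈ B N, instSet φ b

/-- A complete type over `∅` (in the variables `γ`), presented as the set of formulas
realized by some tuple in some model of `T`. -/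
def IsRealizedType {γ : Type*} (p : Set (L.Formula γ)) : Prop :=
  ∃ (M : Theory.ModelType.{u, v, max u v} T) (a : γ → M), typeOf a = p

/-- `p ⟶ q`: there are a model of `T`, a tuple `b` and an indiscernible sequence `(aᵢ)`
with `aᵢ ⊨ p(x, b)` for `i > 0` and `a₀ ⊨ q(x, b)`. -/
def Pf {α β : Type*} (p q : Set (L.Formula (α ⊕ β))) : Prop :=
  ∃ (M : Theory.ModelType.{u, v, max u v} T) (b : β → M) (a : ℕ → α → M),
    IsIndiscernible (L := L) a ∧ (∀ i : ℕ, 0 < i → typeOf (Sum.elim (a i) b) = p) ∧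
      typeOf (Sum.elim (a 0) b) = q

section Stab

variable {M : Type w} [L.Structure M]

/-- Indiscernibility over a set `C` of parameters. -/
def IsIndiscernibleOver (C : Set M) {I : Type*} [LinearOrder I] {γ : Type*}
    (a : I → γ → M) : Prop :=
  ∀ (n m : ℕ) (i j : Fin n → I), StrictMono i → StrictMono j →
    ∀ c : Fin m → M, (∀ t, c t ∈ C) →
      ∀ φ : L.Formula ((Fin n × γ) ⊕ Fin m),
        φ.Realize (Sum.elim (fun p => a (i p.1) p.2) c) ↔
          φ.Realize (Sum.elim (fun p => a (j p.1) p.2) c)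

/-- The formula `φ(x, d)` divides over `C`: there is a `C`-indiscernible sequence starting
at `d` along which the instances of `φ` are `k`-inconsistent. -/
def Divides {α γ : Type*} (φ : L.Formula (α ⊕ γ)) (d : γ → M) (C : Set M) : Prop :=
  ∃ (k : ℕ) (d' : ℕ → γ → M), 0 < k ∧ d' 0 = d ∧ IsIndiscernibleOver (L := L) C d' ∧
    ∀ s : Finset ℕ, s.card = k → ¬ ∃ a : α → M, ∀ i ∈ s, φ.Realize (Sum.elim a (d' i))

/-- `a` is forking-independent from `B` over `C` (in a stable theory, nonforking equals
nondividing): no formula of `tp(a / B ∪ C)` divides over `C`. -/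
def IndepOver {α : Type*} (a : α → M) (B C : Set M) : Prop :=
  ∀ (m : ℕ) (c : Fin m → M), (∀ t, c t ∈ B ∪ C) →
    ∀ φ : L.Formula (α ⊕ Fin m),
      φ.Realize (Sum.elim a c) → ¬ Divides (L := L) φ c C

/-- `p(x, b) ⟶ q(x, b)` for types over the parameter tuple `b` inside the model `M`. -/
def PfOver {α β : Type*} (b : β → M) (p q : Set (L.Formula (α ⊕ β))) : Prop :=
  ∃ a : ℕ → α → M, IsIndiscernible (L := L) a ∧
    (∀ i : ℕ, 0 < i → typeOf (Sum.elim (a i) b) = p) ∧ typeOf (Sum.elim (a 0) b) = q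

/-- A sufficiently saturated and homogeneous ("monster") structure: types over small parameter
sets are realized, and small tuples with the same type are conjugate step by step. -/
structure IsMonster (M : Type w) [L.Structure M] : Prop where
  saturated : ∀ (β : Type w) (b : β → M), Cardinal.mk β < Cardinal.mk M →
    ∀ (α : Type w), Finite α → ∀ Γ : Set (L.Formula (α ⊕ β)),
      (∀ Γ₀ : Finset (L.Formula (α ⊕ β)), ↑Γ₀ ⊆ Γ →
        ∃ a : α → M, ∀ φ ∈ Γ₀, φ.Realize (Sum.elim a b)) →
      ∃ a : α → M, ∀ φ ∈ Γ, φ.Realize (Sum.elim a b)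
  homogeneous : ∀ (β : Type w) (b b' : β → M), Cardinal.mk β < Cardinal.mk M →
    typeOf (L := L) b = typeOf b' → ∀ x : M, ∃ x' : M,
      typeOf (L := L) (Sum.elim (fun _ : Unit => x) b) =
        typeOf (Sum.elim (fun _ : Unit => x') b')

end Stab

/-- `T` is stable: no formula has the order property in a model of `T`. -/
def IsStable : Prop :=
  ∀ (n m : ℕ) (φ : L.Formula (Fin n ⊕ Fin m)) (M : Theory.ModelType.{u, v, max u v} T)
    (a : ℕ → Fin n → M) (b : ℕ → Fin m → M),
    ¬ ∀ i j : ℕ, φ.Realize (Sum.elim (a i) (b j)) ↔ i < j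
section Imag

variable {M : Type w} [L.Structure M]

/-- `E` defines an equivalence relation on `n`-tuples of `M`. -/
def IsEqRelFormula (n : ℕ) (E : L.Formula (Fin n ⊕ Fin n)) (M : Type w) [L.Structure M] :
    Prop :=
  (∀ a : Fin n → M, E.Realize (Sum.elim a a)) ∧
  (∀ a b : Fin n → M, E.Realize (Sum.elim a b) → E.Realize (Sum.elim b a)) ∧
  (∀ a b c : Fin n → M, E.Realize (Sum.elim a b) → E.Realize (Sum.elim b c) →
    E.Realize (Sum.elim a c))

/-- An imaginary element of `M` (an element of `M^eq`): a class of a `∅`-definable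
equivalence relation on finite tuples. -/
structure Im (L : FirstOrder.Language.{u, v}) (M : Type w) [L.Structure M] where
  n : ℕ
  E : L.Formula (Fin n ⊕ Fin n)
  isEqRel : IsEqRelFormula n E M
  cls : Set (Fin n → M)
  isCls : ∃ a : Fin n → M, cls = {b | E.Realize (Sum.elim a b)}

/-- The variable sort corresponding to a finite tuple `e` of imaginaries. -/
abbrev ImVars {k : ℕ} (e : Fin k → Im L M) : Type _ := Σ r : Fin k, Fin ((e r).n)

/-- A choice of representatives for a tuple of imaginaries. -/
def IsRep {k : ℕ} (e : Fin k → Im L M) (c : ∀ r : Fin k, Fin ((e r).n) → M) : Prop :=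
  ∀ r, c r ∈ (e r).cls

/-- A formula with an imaginary-parameter block is invariant if its truth value does not
depend on the choice of representatives. -/
def ImInvariant {γ : Type*} {k : ℕ} (e : Fin k → Im L M)
    (φ : L.Formula (γ ⊕ ImVars e)) : Prop :=
  ∀ (d : γ → M) (c c' : ∀ r, Fin ((e r).n) → M), IsRep e c → IsRep e c' →
    (φ.Realize (Sum.elim d fun q => c q.1 q.2) ↔ φ.Realize (Sum.elim d fun q => c' q.1 q.2))

/-- The complete type of a real tuple `d` over a tuple of imaginaries `e` : the set of
invariant formulas over `e` satisfied by `d`. -/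
def typeOverIm {γ : Type*} {k : ℕ} (e : Fin k → Im L M) (d : γ → M) :
    Set (L.Formula (γ ⊕ ImVars e)) :=
  {φ | ImInvariant (L := L) e φ ∧
    ∀ c : ∀ r, Fin ((e r).n) → M, IsRep e c → φ.Realize (Sum.elim d fun q => c q.1 q.2)}

/-- The imaginary `e` lies in `acl^eq(X)`, for a set `X` of real elements: some `X`-definable
`E`-invariant formula holds of `e` and of only finitely many `E`-classes. -/
def InAclEq (X : Set M) (e : Im L M) : Prop :=
  ∃ (m : ℕ) (c : Fin m → M) (φ : L.Formula (Fin e.n ⊕ Fin m)),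
    (∀ t, c t ∈ X) ∧
    (∀ a b : Fin e.n → M, e.E.Realize (Sum.elim a b) →
      (φ.Realize (Sum.elim a c) ↔ φ.Realize (Sum.elim b c))) ∧
    (∀ a ∈ e.cls, φ.Realize (Sum.elim a c)) ∧
    {D : Set (Fin e.n → M) | (∃ a : Fin e.n → M, D = {b | e.E.Realize (Sum.elim a b)}) ∧
      ∀ a ∈ D, φ.Realize (Sum.elim a c)}.Finite

/-- Indiscernibility of a sequence over an imaginary tuple `e`. -/
def IsIndiscernibleOverIm {k : ℕ} (e : Fin k → Im L M) {I : Type*} [LinearOrder I]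
    {γ : Type*} (a : I → γ → M) : Prop :=
  ∀ (n : ℕ) (i j : Fin n → I), StrictMono i → StrictMono j →
    ∀ φ : L.Formula ((Fin n × γ) ⊕ ImVars e), ImInvariant (L := L) e φ →
      ∀ c : ∀ r, Fin ((e r).n) → M, IsRep e c →
        (φ.Realize (Sum.elim (fun p => a (i p.1) p.2) fun q => c q.1 q.2) ↔
          φ.Realize (Sum.elim (fun p => a (j p.1) p.2) fun q => c q.1 q.2))

/-- The formula `φ(x, d)` divides over the imaginary tuple `e`. -/
def DividesIm {α γ : Type*} {k : ℕ} (φ : L.Formula (α ⊕ γ)) (d : γ → M)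
    (e : Fin k → Im L M) : Prop :=
  ∃ (kk : ℕ) (d' : ℕ → γ → M), 0 < kk ∧ d' 0 = d ∧
    IsIndiscernibleOverIm (L := L) e d' ∧
    ∀ s : Finset ℕ, s.card = kk → ¬ ∃ a : α → M, ∀ i ∈ s, φ.Realize (Sum.elim a (d' i))

/-- `a` is forking-independent from `B` over the imaginary tuple `e`. -/
def IndepOverIm {α : Type*} {k : ℕ} (a : α → M) (B : Set M) (e : Fin k → Im L M) : Prop :=
  ∀ (m : ℕ) (c : Fin m → M), (∀ t, c t ∈ B) →
    ∀ φ : L.Formula (α ⊕ (Fin m ⊕ ImVars e)),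
      (∀ (x : α → M) (c0 : Fin m → M) (r1 r2 : ∀ r, Fin ((e r).n) → M),
        IsRep e r1 → IsRep e r2 →
        (φ.Realize (Sum.elim x (Sum.elim c0 fun q => r1 q.1 q.2)) ↔
          φ.Realize (Sum.elim x (Sum.elim c0 fun q => r2 q.1 q.2)))) →
      ∀ rep : ∀ r, Fin ((e r).n) → M, IsRep e rep →
        φ.Realize (Sum.elim a (Sum.elim c fun q => rep q.1 q.2)) →
        ¬ DividesIm (L := L) φ (Sum.elim c fun q => rep q.1 q.2) e

/-- `d` and `d'` have the same type over `B ∪ e`. -/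
def SameTypeOverIm {γ : Type*} {k : ℕ} (d d' : γ → M) (B : Set M)
    (e : Fin k → Im L M) : Prop :=
  ∀ (m : ℕ) (c : Fin m → M), (∀ t, c t ∈ B) →
    ∀ φ : L.Formula (γ ⊕ (Fin m ⊕ ImVars e)),
      (∀ (x : γ → M) (c0 : Fin m → M) (r1 r2 : ∀ r, Fin ((e r).n) → M),
        IsRep e r1 → IsRep e r2 →
        (φ.Realize (Sum.elim x (Sum.elim c0 fun q => r1 q.1 q.2)) ↔
          φ.Realize (Sum.elim x (Sum.elim c0 fun q => r2 q.1 q.2)))) →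
      ∀ rep : ∀ r, Fin ((e r).n) → M, IsRep e rep →
        (φ.Realize (Sum.elim d (Sum.elim c fun q => rep q.1 q.2)) ↔
          φ.Realize (Sum.elim d' (Sum.elim c fun q => rep q.1 q.2)))

/-- A type over the imaginary tuple `e` is stationary: realizations independent from a set `B`
over `e` all have the same type over `B ∪ e`. -/
def IsStationaryOverIm {γ : Type*} {k : ℕ} (e : Fin k → Im L M)
    (p : Set (L.Formula (γ ⊕ ImVars e))) : Prop :=
  ∀ d d' : γ → M, typeOverIm (L := L) e d = p → typeOverIm (L := L) e d' = p →
    ∀ B : Set M, IndepOverIm (L := L) d B e → IndepOverIm (L := L) d' B e →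
      SameTypeOverIm (L := L) d d' B e

/-- `p ⟶ q` for types over the imaginary tuple `e`, with variable partition `(α; β)`. -/
def PfOverIm {α β : Type*} {k : ℕ} (e : Fin k → Im L M)
    (p q : Set (L.Formula ((α ⊕ β) ⊕ ImVars e))) : Prop :=
  ∃ (b : β → M) (a : ℕ → α → M), IsIndiscernible (L := L) a ∧
    (∀ i : ℕ, 0 < i → typeOverIm (L := L) e (Sum.elim (a i) b) = p) ∧
    typeOverIm (L := L) e (Sum.elim (a 0) b) = q

end Imag
/-- `r` is the product `p₁ ⊗ p₂` of the stationary types `p₁` and `p₂` over the imaginary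
tuple `e`: the type over `e` of a pair of independent realizations. -/
def IsTensor {M : Type w} [L.Structure M] {α₁ β₁ α₂ β₂ : Type*} {k : ℕ}
    (e : Fin k → Im L M)
    (p₁ : Set (L.Formula ((α₁ ⊕ β₁) ⊕ ImVars e)))
    (p₂ : Set (L.Formula ((α₂ ⊕ β₂) ⊕ ImVars e)))
    (r : Set (L.Formula (((α₁ ⊕ α₂) ⊕ (β₁ ⊕ β₂)) ⊕ ImVars e))) : Prop :=
  ∃ (a₁ : α₁ → M) (b₁ : β₁ → M) (a₂ : α₂ → M) (b₂ : β₂ → M),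
    typeOverIm (L := L) e (Sum.elim a₁ b₁) = p₁ ∧
    typeOverIm (L := L) e (Sum.elim a₂ b₂) = p₂ ∧
    IndepOverIm (L := L) (Sum.elim a₁ b₁) (range a₂ ∪ range b₂) e ∧
    typeOverIm (L := L) e (Sum.elim (Sum.elim a₁ a₂) (Sum.elim b₁ b₂)) = r

set_option linter.unusedSectionVars false
set_option linter.unusedVariables false

section FDsec

/-- A `∅`-definable predicate on `X`-tuples. -/
def FD (L : FirstOrder.Language.{u, v}) {M : Type w} [L.Structure M] {X : Type*}
    (S : (X → M) → Prop) : Prop :=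
  ∃ φ : L.Formula X, ∀ x, S x ↔ φ.Realize x

variable {M : Type w} [L.Structure M] {X Y Z : Type*}

theorem FD.of (φ : L.Formula X) : FD L (fun x : X → M => φ.Realize x) := ⟨φ, fun _ => Iff.rfl⟩

theorem FD.congr {S S' : (X → M) → Prop} (h : FD L S) (hh : ∀ x, S' x ↔ S x) : FD L S' := by
  obtain ⟨φ, hφ⟩ := h
  exact ⟨φ, fun x => (hh x).trans (hφ x)⟩

theorem FD.and {S S' : (X → M) → Prop} (h : FD L S) (h' : FD L S') :
    FD L (fun x => S x ∧ S' x) := by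
  obtain ⟨φ, hφ⟩ := h
  obtain ⟨ψ, hψ⟩ := h'
  exact ⟨φ ⊓ ψ, fun x => by simp only [Formula.realize_inf, hφ, hψ]⟩

theorem FD.not {S : (X → M) → Prop} (h : FD L S) : FD L (fun x => ¬ S x) := by
  obtain ⟨φ, hφ⟩ := h
  exact ⟨∼φ, fun x => by simp only [Formula.realize_not, hφ]⟩

theorem FD.or {S S' : (X → M) → Prop} (h : FD L S) (h' : FD L S') :
    FD L (fun x => S x ∨ S' x) :=
  ((h.not.and h'.not).not).congr fun x => by tauto

theorem FD.imp {S S' : (X → M) → Prop} (h : FD L S) (h' : FD L S') :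
    FD L (fun x => S x → S' x) :=
  ((h.and h'.not).not).congr fun x => by tauto

theorem FD.iff {S S' : (X → M) → Prop} (h : FD L S) (h' : FD L S') :
    FD L (fun x => S x ↔ S' x) :=
  ((h.imp h').and (h'.imp h)).congr fun x => by tauto

theorem FD.true : FD L (fun _ : X → M => True) := ⟨⊤, fun x => by simp⟩

theorem FD.const (p : Prop) : FD L (fun _ : X → M => p) := by
  by_cases hp : p
  · exact FD.true.congr fun _ => by simp [hp]
  · exact FD.true.not.congr fun _ => by simp [hp]

theorem FD.comp {S : (X → M) → Prop} (h : FD L S) (g : X → Y) :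
    FD L (fun y : Y → M => S (y ∘ g)) := by
  obtain ⟨φ, hφ⟩ := h
  exact ⟨φ.relabel g, fun x => by simp only [Formula.realize_relabel, hφ]⟩

theorem FD.fin_restrict {S : (X → M) → Prop} (h : FD L S) :
    ∃ (n : ℕ) (v : Fin n → X) (S' : (Fin n → M) → Prop), Function.Injective v ∧ FD L S' ∧
      ∀ x, S x ↔ S' (x ∘ v) := by
  classical
  obtain ⟨φ, hφ⟩ := h
  let e := φ.freeVarFinset.equivFin
  refine ⟨_, fun i => (e.symm i : X), _, ?_, FD.of (BoundedFormula.restrictFreeVar φ e), ?_⟩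
  · intro i j hij
    exact e.symm.injective (Subtype.ext hij)
  · intro x
    rw [hφ]
    exact (BoundedFormula.realize_restrictFreeVar x (by intro a; simp)).symm

theorem FD.ex [Nonempty M] {S : (X ⊕ Y → M) → Prop} (h : FD L S) :
    FD L (fun y : Y → M => ∃ x : X → M, S (Sum.elim x y)) := by
  classical
  obtain ⟨n, v, S', hv, ⟨φ, hφ⟩, hS⟩ := h.fin_restrict
  let g : Fin n → Y ⊕ Fin n := fun i => Sum.elim (fun _ => Sum.inr i) Sum.inl (v i)
  refine ⟨(φ.relabel g).iExs (Fin n), fun y => ?_⟩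
  rw [Formula.realize_iExs]
  simp only [Formula.realize_relabel, hS, hφ]
  constructor
  · rintro ⟨x, hx⟩
    refine ⟨fun i => Sum.elim x y (v i), ?_⟩
    convert hx using 1
    funext i
    simp only [Function.comp, g]
    rcases hvi : v i with t | t <;> simp [hvi]
  · rintro ⟨z, hz⟩
    let x : X → M := fun t => if h : ∃ i, v i = Sum.inl t then z h.choose else Classical.arbitrary M
    refine ⟨x, ?_⟩
    convert hz using 1
    funext i
    simp only [Function.comp, g]
    rcases hvi : v i with t | t
    · simp only [Sum.elim_inl, Sum.elim_inr, x]
      have h : ∃ i, v i = Sum.inl t := ⟨i, hvi⟩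
      rw [dif_pos h]
      congr 1
      exact hv (h.choose_spec.trans hvi.symm)
    · simp

theorem FD.all [Nonempty M] {S : (X ⊕ Y → M) → Prop} (h : FD L S) :
    FD L (fun y : Y → M => ∀ x : X → M, S (Sum.elim x y)) :=
  h.not.ex.not.congr fun x => by simp

theorem FD.forall_finset {ι : Type*} (s : Finset ι) {S : ι → (X → M) → Prop}
    (h : ∀ i ∈ s, FD L (S i)) : FD L (fun x => ∀ i ∈ s, S i x) := by
  classical
  induction s using Finset.induction_on with
  | empty => exact FD.true.congr (by simp)
  | insert a s ha ih =>
    exact ((h a (by simp)).and (ih fun i hi => h i (by simp [hi]))).congr (by simp)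

theorem FD.forall_finite {ι : Type*} [Finite ι] {S : ι → (X → M) → Prop}
    (h : ∀ i, FD L (S i)) : FD L (fun x => ∀ i, S i x) := by
  classical
  cases nonempty_fintype ι
  exact (FD.forall_finset Finset.univ fun i _ => h i).congr (by simp)

theorem FD.exists_finite {ι : Type*} [Finite ι] {S : ι → (X → M) → Prop}
    (h : ∀ i, FD L (S i)) : FD L (fun x => ∃ i, S i x) :=
  (FD.forall_finite fun i => (h i).not).not.congr (by simp)

theorem FD.eq [Finite X] (d : X → Y) (d' : X → Y) :
    FD L (fun y : Y → M => y ∘ d = y ∘ d') := by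
  have : ∀ i : X, FD L (fun y : Y → M => y (d i) = y (d' i)) := fun i =>
    ⟨Term.equal (Term.var (d i)) (Term.var (d' i)), fun y => by simp [Formula.realize_equal]⟩
  exact (FD.forall_finite this).congr fun y => by rw [funext_iff]; rfl

/-- Agreement of types over `∅`. -/
def Same (L : FirstOrder.Language.{u, v}) {M : Type w} [L.Structure M] {X : Type*}
    (a b : X → M) : Prop := ∀ S : (X → M) → Prop, FD L S → S a → S b

theorem Same.refl (a : X → M) : Same L a a := fun _ _ h => h

theorem Same.symm {a b : X → M} (h : Same L a b) : Same L b a := fun S hS hb => by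
  by_contra hn
  exact h _ hS.not hn hb

theorem Same.trans {a b c : X → M} (h : Same L a b) (h' : Same L b c) : Same L a c :=
  fun S hS ha => h' S hS (h S hS ha)

theorem Same.comp {a b : X → M} (h : Same L a b) (g : Y → X) : Same L (a ∘ g) (b ∘ g) :=
  fun _ hS ha => h _ (hS.comp g) ha

theorem Same.iff {a b : X → M} (h : Same L a b) {S : (X → M) → Prop} (hS : FD L S) :
    S a ↔ S b := ⟨h S hS, h.symm S hS⟩

theorem Same.of_fin {a b : X → M}
    (h : ∀ (n : ℕ) (v : Fin n → X), Same L (a ∘ v) (b ∘ v)) : Same L a b := by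
  intro S hS ha
  obtain ⟨n, v, S', -, hS', hh⟩ := hS.fin_restrict
  rw [hh] at ha ⊢
  exact h n v S' hS' ha

end FDsec

section Sat

variable {M : Type w} [L.Structure M] {X Y Z : Type*}

/-- One-variable saturation over finite parameter tuples. -/
def OSat (L : FirstOrder.Language.{u, v}) (M : Type w) [L.Structure M] : Prop :=
  ∀ (n : ℕ) (d : Fin n → M) (F : Filter M), F.NeBot → ∃ z : M,
    ∀ S : (Unit ⊕ Fin n → M) → Prop, FD L S →
      (∀ᶠ y in F, S (Sum.elim (fun _ => y) d)) → S (Sum.elim (fun _ => z) d)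

theorem osat_of_monster (hM : IsMonster (L := L) M) : OSat L M := by
  classical
  intro n d F hF
  rcases finite_or_infinite M with hfin | hinf
  · have h1 : ⋂₀ F.sets ∈ F := (Filter.sInter_mem (Set.toFinite _)).2 fun s hs => hs
    obtain ⟨z, hz⟩ := hF.nonempty_of_mem h1
    exact ⟨z, fun S _ h => hz _ h⟩
  · have hcard : Cardinal.mk (ULift.{w} (Fin n)) < Cardinal.mk M :=
      lt_of_lt_of_le (Cardinal.lt_aleph0_of_finite _) (Cardinal.aleph0_le_mk M)
    obtain ⟨a, ha⟩ := hM.saturated (ULift.{w} (Fin n)) (d ∘ ULift.down) hcard (ULift.{w} Unit)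
      inferInstance {φ | ∀ᶠ y in F, φ.Realize (Sum.elim (fun _ => y) (d ∘ ULift.down))} (by
        intro Γ₀ hΓ
        have : ∀ᶠ y in F, ∀ φ ∈ Γ₀, φ.Realize (Sum.elim (fun _ => y) (d ∘ ULift.down)) :=
          (Filter.eventually_all_finset Γ₀).2 fun φ hφ => hΓ hφ
        obtain ⟨y, hy⟩ := this.exists
        exact ⟨fun _ => y, hy⟩)
    refine ⟨a ⟨()⟩, fun S hS hev => ?_⟩
    let g : Unit ⊕ Fin n → ULift.{w} Unit ⊕ ULift.{w} (Fin n) := Sum.map ULift.up ULift.up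
    obtain ⟨φ, hφ⟩ := hS.comp g
    have key : ∀ y : ULift.{w} Unit → M,
        (Sum.elim y (d ∘ ULift.down) ∘ g) = Sum.elim (fun _ => y ⟨()⟩) d := by
      intro y
      funext t
      rcases t with t | t <;> rfl
    have hφ' : ∀ x, S (x ∘ g) ↔ φ.Realize x := hφ
    have h2 := ha φ (by
      show ∀ᶠ y in F, φ.Realize (Sum.elim (fun _ => y) (d ∘ ULift.down))
      filter_upwards [hev] with y hy
      rw [← hφ', key]
      exact hy)
    rw [← hφ', key] at h2
    exact h2

theorem osat_gen (h : OSat L M) {ι : Type*} [Finite ι] (d : ι → M) (F : Filter M)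
    (hF : F.NeBot) : ∃ z : M, ∀ S : (Unit ⊕ ι → M) → Prop, FD L S →
      (∀ᶠ y in F, S (Sum.elim (fun _ => y) d)) → S (Sum.elim (fun _ => z) d) := by
  obtain ⟨n, ⟨e⟩⟩ := Finite.exists_equiv_fin ι
  obtain ⟨z, hz⟩ := h n (d ∘ e.symm) F hF
  refine ⟨z, fun S hS hev => ?_⟩
  have key : ∀ y : M, Sum.elim (fun _ : Unit => y) (d ∘ e.symm) ∘ Sum.map id e
      = Sum.elim (fun _ => y) d := by
    intro y
    funext t
    rcases t with t | t <;> simp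
  have := hz _ (hS.comp (Sum.map id e)) (by
    filter_upwards [hev] with y hy
    rw [key]; exact hy)
  rwa [key] at this

/-- Partial realization used in the inductive construction. -/
def PReal (L : FirstOrder.Language.{u, v}) {M : Type w} [L.Structure M] {ι : Type*} (d : ι → M)
    (F : Filter (ℕ → M)) (n : ℕ) (a : ℕ → M) : Prop :=
  ∀ S : (ℕ ⊕ ι → M) → Prop, FD L S → (∀ᶠ x in F, S (Sum.elim x d)) →
    ∃ y : ℕ → M, (∀ i < n, y i = a i) ∧ S (Sum.elim y d)

theorem preal_step [Nonempty M] (h : OSat L M) {ι : Type*} [Finite ι] (d : ι → M)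
    (F : Filter (ℕ → M)) (n : ℕ) (a : ℕ → M) (hI : PReal L d F n a) :
    ∃ z, PReal L d F (n + 1) (Function.update a n z) := by
  classical
  let J := {S : (ℕ ⊕ ι → M) → Prop // FD L S ∧ ∀ᶠ x in F, S (Sum.elim x d)}
  let B : J → Set (ℕ → M) := fun S => {y | (∀ i < n, y i = a i) ∧ S.1 (Sum.elim y d)}
  have : Nonempty J := ⟨⟨fun _ => True, FD.true, by simp⟩⟩
  have hdir : Directed (· ≥ ·) (fun S : J => Filter.principal (B S)) := by
    intro S S'
    refine ⟨⟨fun x => S.1 x ∧ S'.1 x, S.2.1.and S'.2.1, S.2.2.and S'.2.2⟩, ?_, ?_⟩ <;>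
    · simp only [ge_iff_le, Filter.le_principal_iff, Filter.mem_principal]
      intro y hy
      first
        | exact ⟨hy.1, hy.2.1⟩
        | exact ⟨hy.1, hy.2.2⟩
  have hne : (⨅ S : J, Filter.principal (B S)).NeBot := by
    refine Filter.iInf_neBot_of_directed' hdir fun S => ?_
    rw [Filter.principal_neBot_iff]
    exact hI S.1 S.2.1 S.2.2
  obtain ⟨z, hz⟩ := osat_gen h (Sum.elim (fun i : Fin n => a i) d)
    (Filter.map (fun y => y n) (⨅ S : J, Filter.principal (B S))) (hne.map _)
  refine ⟨z, fun S hS hev => ?_⟩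
  let v : ℕ → ℕ ⊕ (Unit ⊕ (Fin n ⊕ ι)) := Sum.inl
  have hfd : FD L (fun w : ℕ ⊕ (Unit ⊕ (Fin n ⊕ ι)) → M =>
      ((w ∘ fun i : Fin n => Sum.inl (i : ℕ)) = (w ∘ fun i : Fin n => Sum.inr (Sum.inr (Sum.inl i))))
      ∧ ((w ∘ fun _ : Unit => Sum.inl n) = w ∘ fun _ : Unit => Sum.inr (Sum.inl ())) ∧
      S (w ∘ Sum.map id (fun i => Sum.inr (Sum.inr i)))) :=
    (FD.eq _ _).and ((FD.eq _ _).and (hS.comp _))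
  have hk := hz _ hfd.ex (by
    rw [Filter.eventually_map]
    refine Filter.mem_of_superset (Filter.mem_iInf_of_mem ⟨S, hS, hev⟩
      (Filter.mem_principal_self _)) ?_
    rintro y ⟨hy1, hy2⟩
    refine ⟨y, ?_, ?_, ?_⟩
    · funext i
      exact hy1 i i.2
    · rfl
    · convert hy2 using 1
      funext t
      rcases t with t | t <;> rfl)
  obtain ⟨y, hy1, hy2, hy3⟩ := hk
  refine ⟨y, ?_, ?_⟩
  · intro i hi
    rcases Nat.lt_succ_iff_lt_or_eq.1 hi with h' | h'
    · rw [Function.update_of_ne h'.ne]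
      exact congrFun hy1 ⟨i, h'⟩
    · subst h'
      rw [Function.update_self]
      exact congrFun hy2 ()
  · convert hy3 using 1
    funext t
    rcases t with t | t <;> rfl

theorem exists_real_nat [Nonempty M] (h : OSat L M) {ι : Type*} [Finite ι] (d : ι → M)
    (F : Filter (ℕ → M)) (hF : F.NeBot) : ∃ a : ℕ → M, ∀ S : (ℕ ⊕ ι → M) → Prop, FD L S →
      (∀ᶠ x in F, S (Sum.elim x d)) → S (Sum.elim a d) := by
  classical
  choose st hst using preal_step (L := L) h d F
  let f : ∀ n : ℕ, {a : ℕ → M // PReal L d F n a} := fun n => Nat.rec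
    ⟨fun _ => Classical.arbitrary M, fun S _ hev => by
      obtain ⟨y, hy⟩ := hev.exists
      exact ⟨y, by simp, hy⟩⟩
    (fun n a => ⟨Function.update a.1 n (st n a.1 a.2), hst n a.1 a.2⟩) n
  have hf : ∀ n, (f (n + 1)).1 = Function.update (f n).1 n (st n (f n).1 (f n).2) := fun n => rfl
  have hst' : ∀ i k, (f (i + 1 + k)).1 i = (f (i + 1)).1 i := by
    intro i k
    induction k with
    | zero => rfl
    | succ k ih =>
      rw [← add_assoc, hf, Function.update_of_ne (by omega), ih]
  refine ⟨fun i => (f (i + 1)).1 i, fun S hS hev => ?_⟩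
  obtain ⟨m, v, S', -, hS', hh⟩ := hS.fin_restrict
  obtain ⟨N, hN⟩ : ∃ N, ∀ i (t : ℕ), v i = Sum.inl t → t < N := by
    refine ⟨(Finset.univ.sup fun i => Sum.elim id (fun _ => 0) (v i)) + 1, fun i t ht => ?_⟩
    have : Sum.elim id (fun _ => 0) (v i) ≤
      Finset.univ.sup fun i => Sum.elim id (fun _ => 0) (v i) :=
      Finset.le_sup (f := fun i => Sum.elim id (fun _ => 0) (v i)) (Finset.mem_univ i)
    rw [ht] at this
    simp only [Sum.elim_inl, id] at this
    omega
  obtain ⟨y, hy1, hy2⟩ := (f N).2 S hS hev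
  rw [hh] at hy2 ⊢
  convert hy2 using 1
  funext i
  simp only [Function.comp]
  rcases hvi : v i with t | t
  · have ht := hN i t hvi
    simp only [Sum.elim_inl]
    rw [hy1 t ht]
    obtain ⟨k, rfl⟩ := Nat.exists_eq_add_of_le ht
    exact (hst' t k).symm
  · rfl

/-- Realization of complete types in countably many variables over finite tuples. -/
theorem exists_real [Nonempty M] (h : OSat L M) [Countable X] {ι : Type*} [Finite ι] (d : ι → M)
    (F : Filter (X → M)) (hF : F.NeBot) : ∃ a : X → M, ∀ S : (X ⊕ ι → M) → Prop, FD L S →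
      (∀ᶠ x in F, S (Sum.elim x d)) → S (Sum.elim a d) := by
  classical
  obtain ⟨g, hg⟩ := Countable.exists_injective_nat X
  let up : (X → M) → (ℕ → M) := fun x => Function.extend g x (fun _ => Classical.arbitrary M)
  have hup : ∀ x, up x ∘ g = x := fun x => funext fun t => by
    simp only [Function.comp, up]
    exact hg.extend_apply _ _ t
  obtain ⟨a, ha⟩ := exists_real_nat h d (F.map up) (hF.map _)
  have key : ∀ y : ℕ → M, Sum.elim y d ∘ Sum.map g id = Sum.elim (y ∘ g) d := by
    intro y
    funext t
    rcases t with t | t <;> rfl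
  refine ⟨a ∘ g, fun S hS hev => ?_⟩
  rw [← key]
  refine ha _ (hS.comp (Sum.map g id)) ?_
  rw [Filter.eventually_map]
  filter_upwards [hev] with x hx
  rw [key, hup]
  exact hx

/-- Realization of a directed family of definable conditions. -/
theorem realize_family [Nonempty M] (h : OSat L M) [Countable X] {ι : Type*} [Finite ι]
    (d : ι → M) (𝒮 : Set ((X ⊕ ι → M) → Prop)) (hne : 𝒮.Nonempty) (hfd : ∀ S ∈ 𝒮, FD L S)
    (hand : ∀ S ∈ 𝒮, ∀ S' ∈ 𝒮, (fun x => S x ∧ S' x) ∈ 𝒮)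
    (hex : ∀ S ∈ 𝒮, ∃ x : X → M, S (Sum.elim x d)) :
    ∃ a : X → M, ∀ S ∈ 𝒮, S (Sum.elim a d) := by
  let B : 𝒮 → Set (X → M) := fun S => {y | S.1 (Sum.elim y d)}
  have : Nonempty 𝒮 := hne.to_subtype
  have hdir : Directed (· ≥ ·) (fun S : 𝒮 => Filter.principal (B S)) := by
    intro S S'
    refine ⟨⟨fun x => S.1 x ∧ S'.1 x, hand _ S.2 _ S'.2⟩, ?_, ?_⟩ <;>
    · simp only [ge_iff_le, Filter.le_principal_iff, Filter.mem_principal]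
      intro y hy
      first
        | exact hy.1
        | exact hy.2
  have hne : (⨅ S : 𝒮, Filter.principal (B S)).NeBot := by
    refine Filter.iInf_neBot_of_directed' hdir fun S => ?_
    rw [Filter.principal_neBot_iff]
    exact hex S.1 S.2
  obtain ⟨a, ha⟩ := exists_real h d _ hne
  exact ⟨a, fun S hS => ha S (hfd S hS)
    (Filter.mem_iInf_of_mem ⟨S, hS⟩ (Filter.mem_principal_self _))⟩

/-- Homogeneity. -/
theorem same_ext [Nonempty M] (h : OSat L M) [Countable X] {ι : Type*} [Finite ι]
    {d d' : ι → M} (hd : Same L d d') (g : X → M) :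
    ∃ g' : X → M, Same L (Sum.elim g d) (Sum.elim g' d') := by
  obtain ⟨g', hg'⟩ := realize_family h (X := X) d' {S | FD L S ∧ S (Sum.elim g d)}
    ⟨fun _ => True, FD.true, trivial⟩ (fun S hS => hS.1)
    (fun S hS S' hS' => ⟨hS.1.and hS'.1, hS.2, hS'.2⟩)
    (fun S hS => hd _ hS.1.ex ⟨g, hS.2⟩)
  exact ⟨g', fun S hS hx => hg' S ⟨hS, hx⟩⟩

end Sat

section TreeSec

variable {A B : Type*} (φ : A → B → Prop)

/-- Binary splitting trees. -/
def Tree : ℕ → Set A → Set B → Prop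
  | 0, S, _ => S.Nonempty
  | n + 1, S, Y => ∃ b ∈ Y, Tree n (S ∩ {a | φ a b}) Y ∧ Tree n (S ∩ {a | ¬ φ a b}) Y

variable {φ}

theorem Tree.mono : ∀ {n : ℕ} {S S' : Set A} {Y Y' : Set B}, Tree φ n S Y → S ⊆ S' → Y ⊆ Y' →
    Tree φ n S' Y'
  | 0, _, _, _, _, h, hS, _ => Set.Nonempty.mono hS h
  | n + 1, _, _, _, _, ⟨b, hb, h1, h2⟩, hS, hY =>
    ⟨b, hY hb, h1.mono (Set.inter_subset_inter_left _ hS) hY,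
      h2.mono (Set.inter_subset_inter_left _ hS) hY⟩

theorem Tree.nonempty : ∀ {n : ℕ} {S : Set A} {Y : Set B}, Tree φ n S Y → S.Nonempty
  | 0, _, _, h => h
  | _ + 1, _, _, ⟨_, _, h1, _⟩ => h1.nonempty.mono Set.inter_subset_left

theorem Tree.split (N : ℕ) : ∀ {n k : ℕ} {S : Set A} {Y Y1 Y2 : Set B}, n + k = N →
    Tree φ N S Y → Y ⊆ Y1 ∪ Y2 → Tree φ n S Y1 ∨ Tree φ k S Y2 := by
  induction N with
  | zero =>
    intro n k S Y Y1 Y2 h ht hY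
    obtain rfl : n = 0 := by omega
    exact Or.inl ht
  | succ N ih =>
    intro n k S Y Y1 Y2 h ht hY
    rcases n with _ | n
    · exact Or.inl ht.nonempty
    rcases k with _ | k
    · exact Or.inr ht.nonempty
    obtain ⟨b, hb, h1, h2⟩ := ht
    rcases hY hb with hb | hb
    · rcases ih (n := n) (k := k + 1) (by omega) h1 hY with h1 | h1
      · rcases ih (n := n) (k := k + 1) (by omega) h2 hY with h2 | h2
        · exact Or.inl ⟨b, hb, h1, h2⟩
        · exact Or.inr (h2.mono Set.inter_subset_left le_rfl)
      · exact Or.inr (h1.mono Set.inter_subset_left le_rfl)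
    · rcases ih (n := n + 1) (k := k) (by omega) h1 hY with h1 | h1
      · exact Or.inl (h1.mono Set.inter_subset_left le_rfl)
      · rcases ih (n := n + 1) (k := k) (by omega) h2 hY with h2 | h2
        · exact Or.inl (h2.mono Set.inter_subset_left le_rfl)
        · exact Or.inr ⟨b, hb, h1, h2⟩

/-- Finite ladders. -/
def Lad (φ : A → B → Prop) (R : ℕ → ℕ → Prop) (S : Set A) (Y : Set B) (k : ℕ) : Prop :=
  ∃ (a : ℕ → A) (b : ℕ → B), (∀ i < k, a i ∈ S) ∧ (∀ i < k, b i ∈ Y) ∧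
    ∀ i < k, ∀ j < k, (φ (a i) (b j) ↔ R i j)

theorem Lad.mono {R : ℕ → ℕ → Prop} {S S' : Set A} {Y Y' : Set B} {k : ℕ} (h : Lad φ R S Y k)
    (hS : S ⊆ S') (hY : Y ⊆ Y') : Lad φ R S' Y' k := by
  obtain ⟨a, b, h1, h2, h3⟩ := h
  exact ⟨a, b, fun i hi => hS (h1 i hi), fun i hi => hY (h2 i hi), h3⟩

theorem lad_of_tree [Nonempty A] [Nonempty B] (p q : ℕ) : ∃ n, ∀ (S : Set A) (Y : Set B), Tree φ n S Y →
    Lad φ (fun i j => i ≤ j) S Y p ∨ Lad φ (fun i j => j < i) S Y q := by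
  obtain ⟨a0⟩ := ‹Nonempty A›
  obtain ⟨b0⟩ := ‹Nonempty B›
  induction p generalizing q with
  | zero => exact ⟨0, fun S Y _ => Or.inl ⟨fun _ => a0, fun _ => b0, by simp, by simp, by simp⟩⟩
  | succ p ihp =>
    induction q with
    | zero => exact ⟨0, fun S Y _ => Or.inr ⟨fun _ => a0, fun _ => b0, by simp, by simp, by simp⟩⟩
    | succ q ihq =>
      obtain ⟨n1, h1⟩ := ihp (q + 1)
      obtain ⟨n2, h2⟩ := ihq
      refine ⟨(n1 + 1) + (n2 + 1), fun S Y ht => ?_⟩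
      obtain ⟨a, ha⟩ := ht.nonempty
      rcases Tree.split _ (Y1 := Y ∩ {b | φ a b}) (Y2 := Y ∩ {b | ¬ φ a b}) rfl ht (by
        intro b hb
        by_cases h : φ a b
        · exact Or.inl ⟨hb, h⟩
        · exact Or.inr ⟨hb, h⟩) with ⟨b, hb, -, h⟩ | ⟨b, hb, h, -⟩
      · rcases h1 _ _ h with ⟨a', b', ha', hb', hh⟩ | h
        · refine Or.inl ⟨fun i => Nat.casesOn i a a', fun i => Nat.casesOn i b b', ?_, ?_, ?_⟩
          · rintro (_ | i) hi
            · exact ha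
            · exact (ha' i (by omega)).1
          · rintro (_ | i) hi
            · exact hb.1
            · exact (hb' i (by omega)).1
          · rintro (_ | i) hi (_ | j) hj
            · simpa using hb.2
            · simpa using (hb' j (by omega)).2
            · simpa using (ha' i (by omega)).2
            · simpa using hh i (by omega) j (by omega)
        · exact Or.inr (h.mono Set.inter_subset_left Set.inter_subset_left)
      · rcases h2 _ _ h with h | ⟨a', b', ha', hb', hh⟩
        · exact Or.inl (h.mono Set.inter_subset_left Set.inter_subset_left)
        · refine Or.inr ⟨fun i => Nat.casesOn i a a', fun i => Nat.casesOn i b b', ?_, ?_, ?_⟩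
          · rintro (_ | i) hi
            · exact ha
            · exact (ha' i (by omega)).1
          · rintro (_ | i) hi
            · exact hb.1
            · exact (hb' i (by omega)).1
          · rintro (_ | i) hi (_ | j) hj
            · simpa using hb.2
            · simpa using (hb' j (by omega)).2
            · simpa using (ha' i (by omega)).2
            · simpa using hh i (by omega) j (by omega)

end TreeSec

section Stable

variable {M : Type w} [L.Structure M] {X Y Z : Type*}

/-- No order property in `M`. -/
def Stb (L : FirstOrder.Language.{u, v}) (M : Type w) [L.Structure M] : Prop :=
  ∀ (n m : ℕ) (S : (Fin n ⊕ Fin m → M) → Prop), FD L S →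
    ∀ (a : ℕ → Fin n → M) (b : ℕ → Fin m → M), ¬ ∀ i j : ℕ, S (Sum.elim (a i) (b j)) ↔ i < j

theorem no_order (h : Stb L M) {S : (X ⊕ Y → M) → Prop} (hS : FD L S) (a : ℕ → X → M)
    (b : ℕ → Y → M) : ¬ ∀ i j : ℕ, S (Sum.elim (a i) (b j)) ↔ i < j := by
  intro hh
  obtain ⟨n, v, S', -, hS', hv⟩ := hS.fin_restrict
  let g : Fin n → Fin n ⊕ Fin n := fun t => Sum.elim (fun _ => Sum.inl t) (fun _ => Sum.inr t) (v t)
  refine h n n _ (hS'.comp g) (fun i t => Sum.elim (a i) (b 0) (v t))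
    (fun j t => Sum.elim (a 0) (b j) (v t)) fun i j => ?_
  rw [← hh, hv]
  apply iff_of_eq
  congr 1
  funext t
  simp only [Function.comp, g]
  rcases hvt : v t with x | y <;> simp [hvt]

theorem no_order' (h : Stb L M) {S : (X ⊕ Y → M) → Prop} (hS : FD L S) (a : ℕ → X → M)
    (b : ℕ → Y → M) : ¬ ∀ i j : ℕ, S (Sum.elim (a i) (b j)) ↔ j < i := by
  intro hh
  refine no_order h (hS.comp Sum.swap) b a fun i j => ?_
  rw [← hh]
  apply iff_of_eq
  congr 1
  funext t
  rcases t with x | y <;> rfl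

theorem lad_compact [Nonempty M] (hO : OSat L M) [Countable X] [Countable Y]
    {S : (X ⊕ Y → M) → Prop} (hS : FD L S) (R : ℕ → ℕ → Prop)
    (h : ∀ k, Lad (fun (x : X → M) (y : Y → M) => S (Sum.elim x y)) R univ univ k) :
    ∃ (a : ℕ → X → M) (b : ℕ → Y → M), ∀ i j, S (Sum.elim (a i) (b j)) ↔ R i j := by
  let W := ((ℕ × X) ⊕ (ℕ × Y)) ⊕ Fin 0
  let tr : ℕ → ℕ → (W → M) → X ⊕ Y → M := fun i j w =>
    w ∘ Sum.elim (fun x => Sum.inl (Sum.inl (i, x))) (fun y => Sum.inl (Sum.inr (j, y)))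
  obtain ⟨w, hw⟩ := realize_family hO (X := (ℕ × X) ⊕ (ℕ × Y)) (Fin.elim0 : Fin 0 → M)
    {U | FD L U ∧ ∃ k : ℕ, ∀ w, (∀ i < k, ∀ j < k, (S (tr i j w) ↔ R i j)) → U w}
    ⟨fun _ => True, FD.true, 0, fun _ _ => trivial⟩ (fun U hU => hU.1) (by
      rintro U ⟨hU, k, hk⟩ U' ⟨hU', k', hk'⟩
      refine ⟨hU.and hU', max k k', fun w hw => ⟨hk w fun i hi j hj => ?_, hk' w fun i hi j hj => ?_⟩⟩
      · exact hw i (by omega) j (by omega)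
      · exact hw i (by omega) j (by omega)) (by
      rintro U ⟨hU, k, hk⟩
      obtain ⟨a, b, -, -, hab⟩ := h k
      refine ⟨Sum.elim (fun p => a p.1 p.2) (fun p => b p.1 p.2), hk _ fun i hi j hj => ?_⟩
      rw [← hab i hi j hj]
      apply iff_of_eq
      congr 1
      funext t
      rcases t with x | y <;> rfl)
  refine ⟨fun i x => w (Sum.inl (i, x)), fun j y => w (Sum.inr (j, y)), fun i j => ?_⟩
  have := hw (fun w => S (tr i j w) ↔ R i j) ⟨(hS.comp _).iff (FD.const _), max i j + 1, fun w hw =>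
    hw i (by omega) j (by omega)⟩
  rw [← this]
  apply iff_of_eq
  congr 1
  funext t
  rcases t with x | y <;> rfl

theorem tree_bound [Nonempty M] (hO : OSat L M) (hs : Stb L M) [Countable X] [Countable Y]
    {S : (X ⊕ Y → M) → Prop} (hS : FD L S) :
    ∃ N, ¬ Tree (fun (x : X → M) (y : Y → M) => S (Sum.elim x y)) N univ univ := by
  by_contra! hN
  by_cases h1 : ∀ k, Lad (fun (x : X → M) (y : Y → M) => S (Sum.elim x y)) (fun i j => i ≤ j) univ univ k
  · obtain ⟨a, b, hab⟩ := lad_compact hO hS _ h1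
    exact no_order hs hS (fun i => a (i + 1)) b fun i j => hab (i + 1) j
  · by_cases h2 : ∀ k, Lad (fun (x : X → M) (y : Y → M) => S (Sum.elim x y)) (fun i j => j < i) univ univ k
    · obtain ⟨a, b, hab⟩ := lad_compact hO hS _ h2
      exact no_order' hs hS a b hab
    · push Not at h1 h2
      obtain ⟨p, hp⟩ := h1
      obtain ⟨q, hq⟩ := h2
      obtain ⟨n, hn⟩ := lad_of_tree (φ := fun (x : X → M) (y : Y → M) => S (Sum.elim x y)) p q
      rcases hn _ _ (hN n) with h | h
      · exact hp h
      · exact hq h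

end Stable

section CtxSec

/-- The working context: a saturated stable structure together with an imaginary tuple, given
by an equivalence relation and a representative, algebraic over the empty set. -/
structure Ctx (L : FirstOrder.Language.{u, v}) (M : Type w) [L.Structure M] (C : Type) where
  hO : OSat L M
  hs : Stb L M
  Er : (C → M) → (C → M) → Prop
  refl : ∀ z, Er z z
  symm : ∀ {z z'}, Er z z' → Er z' z
  trans : ∀ {z z' z''}, Er z z' → Er z' z'' → Er z z''
  fdE : FD L (fun w : C ⊕ C → M => Er (w ∘ Sum.inl) (w ∘ Sum.inr))
  c : C → M
  Psi : (C → M) → Prop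
  fdP : FD L Psi
  psi : ∀ z, Er c z → Psi z
  Zf : Set (C → M)
  finZ : Zf.Finite
  cov : ∀ z, Psi z → ∃ z' ∈ Zf, Er z z'

variable {M : Type w} [L.Structure M] [Nonempty M] {C : Type} [Finite C] (Γ : Ctx L M C)
variable {ι κ X Y γ : Type*}

/-- The saturation of `S` under the equivalence relation. -/
def Ctx.hat (S : (ι ⊕ C → M) → Prop) : (ι ⊕ C → M) → Prop :=
  fun w => ∃ z : C → M, Γ.Er (w ∘ Sum.inr) z ∧ S (Sum.elim (w ∘ Sum.inl) z)

theorem Ctx.fd_hat {S : (ι ⊕ C → M) → Prop} (hS : FD L S) : FD L (Γ.hat S) := by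
  have h := ((Γ.fdE.comp (Sum.elim (fun t : C => (Sum.inr (Sum.inr t) : C ⊕ (ι ⊕ C)))
    (fun t => Sum.inl t))).and (hS.comp (Sum.elim (fun t : ι => (Sum.inr (Sum.inl t) : C ⊕ (ι ⊕ C)))
    (fun t => Sum.inl t)))).ex
  refine h.congr fun w => ?_
  refine exists_congr fun z => ?_
  refine and_congr Iff.rfl (iff_of_eq ?_)
  congr 1
  funext t
  rcases t with t | t <;> rfl

/-- Same type over the imaginary tuple. -/
def Ctx.EC (d d' : ι → M) : Prop :=
  ∃ z z', Γ.Er Γ.c z ∧ Γ.Er Γ.c z' ∧ Same L (Sum.elim d z) (Sum.elim d' z')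

variable {Γ}

theorem Ctx.EC.refl (d : ι → M) : Γ.EC d d := ⟨Γ.c, Γ.c, Γ.refl _, Γ.refl _, Same.refl _⟩

theorem Ctx.EC.symm {d d' : ι → M} (h : Γ.EC d d') : Γ.EC d' d := by
  obtain ⟨z, z', h1, h2, h3⟩ := h
  exact ⟨z', z, h2, h1, h3.symm⟩

theorem Ctx.EC.comp {d d' : ι → M} (h : Γ.EC d d') (g : κ → ι) : Γ.EC (d ∘ g) (d' ∘ g) := by
  obtain ⟨z, z', h1, h2, h3⟩ := h
  refine ⟨z, z', h1, h2, ?_⟩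
  have := h3.comp (Sum.map g id)
  rwa [Sum.elim_comp_map, Sum.elim_comp_map] at this

theorem Ctx.EC.same {d d' : ι → M} (h : Γ.EC d d') : Same L d d' := by
  obtain ⟨z, z', h1, h2, h3⟩ := h
  have := h3.comp Sum.inl
  rwa [Sum.elim_comp_inl, Sum.elim_comp_inl] at this

theorem Ctx.EC.inv {d d' : ι → M} (h : Γ.EC d d') {S : (ι ⊕ C → M) → Prop} (hS : FD L S)
    (hd : ∃ z, Γ.Er Γ.c z ∧ S (Sum.elim d z)) : ∃ z, Γ.Er Γ.c z ∧ S (Sum.elim d' z) := by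
  obtain ⟨z, z', h1, h2, h3⟩ := h
  obtain ⟨y, hy, hyS⟩ := hd
  obtain ⟨y', hy1, hy2⟩ := h3 _ (Γ.fd_hat hS) ⟨y, Γ.trans (Γ.symm h1) hy, hyS⟩
  exact ⟨y', Γ.trans h2 hy1, hy2⟩

theorem Ctx.EC.at [Finite ι] {d d' : ι → M} (h : Γ.EC d d') {z : C → M} (hz : Γ.Er Γ.c z) :
    ∃ z', Γ.Er Γ.c z' ∧ Same L (Sum.elim d z) (Sum.elim d' z') := by
  obtain ⟨y, y', h1, h2, h3⟩ := h
  obtain ⟨z', hz'⟩ := same_ext Γ.hO h3 z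
  refine ⟨z', ?_, ?_⟩
  · have := hz'.comp (Sum.elim (fun t : C => Sum.inr (Sum.inr t)) (fun t : C => Sum.inl t))
    exact Γ.trans h2 (this _ Γ.fdE (Γ.trans (Γ.symm h1) hz))
  · have := hz'.comp (Sum.elim (fun t : ι => Sum.inr (Sum.inl t)) (fun t : C => Sum.inl t))
    convert this using 1 <;>
    · funext t
      rcases t with t | t <;> rfl

theorem Ctx.EC.trans [Finite ι] {d d' d'' : ι → M} (h : Γ.EC d d') (h' : Γ.EC d' d'') :
    Γ.EC d d'' := by
  obtain ⟨z, z', h1, h2, h3⟩ := h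
  obtain ⟨y, h4, h5⟩ := h'.at h2
  exact ⟨z, y, h1, h4, h3.trans h5⟩

theorem Ctx.EC.ext [Finite ι] [Countable X] {d d' : ι → M} (h : Γ.EC d d') (g : X → M) :
    ∃ g', Γ.EC (Sum.elim g d) (Sum.elim g' d') := by
  obtain ⟨y, y', h1, h2, h3⟩ := h
  obtain ⟨g', hz'⟩ := same_ext Γ.hO h3 g
  refine ⟨g', y, y', h1, h2, ?_⟩
  have := hz'.comp (Equiv.sumAssoc X ι C)
  convert this using 1 <;>
  · funext t
    rcases t with (t | t) | t <;> rfl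

theorem Ctx.EC.of_inv [Finite ι] {d d' : ι → M} (h : ∀ S : (ι ⊕ C → M) → Prop, FD L S →
    S (Sum.elim d Γ.c) → ∃ z, Γ.Er Γ.c z ∧ S (Sum.elim d' z)) : Γ.EC d d' := by
  obtain ⟨z, hz⟩ := realize_family Γ.hO (X := C) (Sum.elim d' Γ.c)
    {U | FD L U ∧ ∃ S : (ι ⊕ C → M) → Prop, FD L S ∧ S (Sum.elim d Γ.c) ∧
      U = fun w => Γ.Er (w ∘ fun t => Sum.inr (Sum.inr t)) (w ∘ Sum.inl) ∧
        S (w ∘ Sum.elim (fun t => Sum.inr (Sum.inl t)) Sum.inl)}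
    ⟨_, ((Γ.fdE.comp (Sum.elim (fun t : C => Sum.inr (Sum.inr t)) Sum.inl)).and
      (FD.true.comp (Sum.elim (fun t : ι => Sum.inr (Sum.inl t)) Sum.inl))),
      fun _ => True, FD.true, trivial, rfl⟩ (fun U hU => hU.1) (by
      rintro U ⟨hU, S, hS, hSd, rfl⟩ U' ⟨hU', S', hS', hSd', rfl⟩
      refine ⟨hU.and hU', fun w => S w ∧ S' w, hS.and hS', ⟨hSd, hSd'⟩, ?_⟩
      funext w
      apply propext
      tauto) (by
      rintro U ⟨hU, S, hS, hSd, rfl⟩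
      obtain ⟨z, h1, h2⟩ := h S hS hSd
      refine ⟨z, h1, ?_⟩
      convert h2 using 1
      funext t
      rcases t with t | t <;> rfl)
  have hz' : ∀ S : (ι ⊕ C → M) → Prop, FD L S → S (Sum.elim d Γ.c) → Γ.Er Γ.c z ∧
      S (Sum.elim d' z) := by
    intro S hS hd
    have := hz _ ⟨((Γ.fdE.comp (Sum.elim (fun t : C => Sum.inr (Sum.inr t)) Sum.inl)).and
      (hS.comp _)), S, hS, hd, rfl⟩
    refine ⟨this.1, ?_⟩
    convert this.2 using 1
    funext t
    rcases t with t | t <;> rfl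
  exact ⟨Γ.c, z, Γ.refl _, (hz' _ FD.true trivial).1, fun S hS hd => (hz' S hS hd).2⟩

end CtxSec

section IndSec

/-- Blockwise separation of index tuples. -/
def Sep {n : ℕ} (i i' : Fin n → ℕ) : Prop := ∀ s t, i s < i' t

theorem sep_append {n : ℕ} {i i' : Fin n → ℕ} (hi : StrictMono i) (hi' : StrictMono i')
    (h : Sep i i') : StrictMono (Fin.append i i') := by
  intro s t hst
  induction s using Fin.addCases with
  | left s =>
    induction t using Fin.addCases with
    | left t =>
      simp only [Fin.append_left]
      exact hi (by rw [Fin.lt_def] at hst ⊢; simpa using hst)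
    | right t =>
      simp only [Fin.append_left, Fin.append_right]
      exact h s t
  | right s =>
    induction t using Fin.addCases with
    | left t =>
      exfalso
      rw [Fin.lt_def] at hst
      simp only [Fin.val_natAdd, Fin.val_castAdd] at hst
      omega
    | right t =>
      simp only [Fin.append_right]
      exact hi' (by rw [Fin.lt_def] at hst ⊢; simpa using hst)

theorem far_exists {n : ℕ} (i j : Fin n → ℕ) : ∃ k : Fin n → ℕ, StrictMono k ∧ Sep i k ∧ Sep j k := by
  refine ⟨fun t => (∑ s, (i s + j s)) + 1 + t, fun s t h => by simpa using h, fun s t => ?_,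
    fun s t => ?_⟩
  · have := Finset.single_le_sum (f := fun s => i s + j s) (fun _ _ => Nat.zero_le _) (Finset.mem_univ s)
    show i s < (∑ s, (i s + j s)) + 1 + t
    omega
  · have := Finset.single_le_sum (f := fun s => i s + j s) (fun _ _ => Nat.zero_le _) (Finset.mem_univ s)
    show j s < (∑ s, (i s + j s)) + 1 + t
    omega

theorem far_pigeon {n : ℕ} {R : (Fin n → ℕ) → (Fin n → ℕ) → Prop}
    (symm : ∀ i j, R i j → R j i) (trans : ∀ i j k, R i j → R j k → R i k)
    {K : Type*} [Finite K] (col : (Fin n → ℕ) → K) (hcol : ∀ i j, col i = col j → R i j)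
    (inv : ∀ i i' j j', StrictMono i → StrictMono i' → StrictMono j → StrictMono j' →
      Sep i i' → Sep j j' → R i i' → R j j') (i j : Fin n → ℕ) (hi : StrictMono i)
    (hj : StrictMono j) : R i j := by
  let f : ℕ → Fin n → ℕ := fun m t => m * n + t
  have hf : ∀ m, StrictMono (f m) := fun m s t h => by simpa [f] using h
  have hsep : ∀ m m', m < m' → Sep (f m) (f m') := by
    intro m m' h s t
    have h1 := s.2
    have h2 : (m + 1) * n ≤ m' * n := Nat.mul_le_mul_right _ h
    simp only [f]
    rw [add_mul] at h2
    omega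
  have hall : ∀ i j, StrictMono i → StrictMono j → Sep i j → R i j := by
    obtain ⟨m, m', hne, he⟩ := Finite.exists_ne_map_eq_of_infinite fun m => col (f m)
    rcases lt_or_gt_of_ne hne with h | h
    · exact fun i j hi hj hij => inv _ _ _ _ (hf m) (hf m') hi hj (hsep _ _ h) hij (hcol _ _ he)
    · exact fun i j hi hj hij => inv _ _ _ _ (hf m') (hf m) hi hj (hsep _ _ h) hij (hcol _ _ he.symm)
  obtain ⟨k, hk, hik, hjk⟩ := far_exists i j
  exact trans _ _ _ (hall _ _ hi hk hik) (symm _ _ (hall _ _ hj hk hjk))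

variable {M : Type w} [L.Structure M] {γ : Type*}

/-- The block of a sequence at an index tuple. -/
def blk {n : ℕ} (d : ℕ → γ → M) (i : Fin n → ℕ) : Fin n × γ → M := fun p => d (i p.1) p.2

theorem ind_same {d : ℕ → γ → M} (hd : IsIndiscernible (L := L) d) {n : ℕ} {i j : Fin n → ℕ}
    (hi : StrictMono i) (hj : StrictMono j) : Same L (blk d i) (blk d j) := by
  rintro S ⟨φ, hφ⟩ h
  rw [hφ] at h ⊢
  exact (hd n i j hi hj φ).1 h

theorem ind_of_same {d : ℕ → γ → M} (h : ∀ (n : ℕ) (i j : Fin n → ℕ), StrictMono i → StrictMono j →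
    Same L (blk d i) (blk d j)) : IsIndiscernible (L := L) d :=
  fun n i j hi hj φ => (h n i j hi hj).iff (FD.of φ)

/-- Reindexing of a pair of blocks. -/
def pairIdx (n : ℕ) (γ : Type*) : (Fin n × γ) ⊕ (Fin n × γ) → Fin (n + n) × γ :=
  Sum.elim (fun p => (Fin.castAdd n p.1, p.2)) (fun p => (Fin.natAdd n p.1, p.2))

theorem blk_pair {n : ℕ} (d : ℕ → γ → M) (i i' : Fin n → ℕ) :
    blk d (Fin.append i i') ∘ pairIdx n γ = Sum.elim (blk d i) (blk d i') := by
  funext t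
  rcases t with t | t
  · simp [blk, pairIdx]
  · simp only [blk, pairIdx, Function.comp, Sum.elim_inr, Fin.append_right]

variable [Nonempty M] {C : Type} [Finite C] {Γ : Ctx L M C}

theorem ind_ec [Finite γ] {d : ℕ → γ → M} (hd : IsIndiscernible (L := L) d) {n : ℕ}
    {i j : Fin n → ℕ} (hi : StrictMono i) (hj : StrictMono j) : Γ.EC (blk d i) (blk d j) := by
  refine Ctx.EC.of_inv fun S hS hSi => ?_
  have hsat : ∀ (D : Fin n × γ → M) z z', Γ.Er z z' → Γ.hat S (Sum.elim D z) →
      Γ.hat S (Sum.elim D z') := by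
    rintro D z z' h ⟨y, hy1, hy2⟩
    exact ⟨y, Γ.trans (Γ.symm h) hy1, hy2⟩
  have : Finite Γ.Zf := Γ.finZ
  have key := far_pigeon (n := n) (R := fun i j => ∀ z, Γ.Psi z →
      (Γ.hat S (Sum.elim (blk d i) z) ↔ Γ.hat S (Sum.elim (blk d j) z)))
    (fun i j h z hz => (h z hz).symm) (fun i j k h h' z hz => (h z hz).trans (h' z hz))
    (K := Γ.Zf → Prop) (fun i z => Γ.hat S (Sum.elim (blk d i) z)) (by
      intro i j h z hz
      obtain ⟨z', hz', hE⟩ := Γ.cov z hz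
      have := congrFun h ⟨z', hz'⟩
      simp only [eq_iff_iff] at this
      constructor
      · intro h1
        exact hsat _ _ _ (Γ.symm hE) (this.1 (hsat _ _ _ hE h1))
      · intro h1
        exact hsat _ _ _ (Γ.symm hE) (this.2 (hsat _ _ _ hE h1))) (by
      intro i i' j j' hi hi' hj hj' hii hjj h
      have hsame := (ind_same (L := L) hd (sep_append hi hi' hii) (sep_append hj hj' hjj)).comp
        (pairIdx n γ)
      rw [blk_pair, blk_pair] at hsame
      have hfd : FD L (fun w : C ⊕ ((Fin n × γ) ⊕ (Fin n × γ)) → M => Γ.Psi (w ∘ Sum.inl) →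
          (Γ.hat S (w ∘ Sum.elim (fun t => Sum.inr (Sum.inl t)) Sum.inl) ↔
            Γ.hat S (w ∘ Sum.elim (fun t => Sum.inr (Sum.inr t)) Sum.inl))) :=
        (Γ.fdP.comp _).imp (((Γ.fd_hat hS).comp _).iff ((Γ.fd_hat hS).comp _))
      have h2 := hsame _ hfd.all h
      exact h2) i j hi hj
  have h1 : Γ.hat S (Sum.elim (blk d i) Γ.c) := ⟨Γ.c, Γ.refl _, hSi⟩
  obtain ⟨z, hz1, hz2⟩ := (key Γ.c (Γ.psi _ (Γ.refl _))).1 h1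
  exact ⟨z, hz1, hz2⟩

theorem ind_ec_pair [Finite γ] {d : ℕ → γ → M} (hd : IsIndiscernible (L := L) d) {n : ℕ}
    {i i' j j' : Fin n → ℕ} (hi : StrictMono i) (hi' : StrictMono i') (hii : Sep i i')
    (hj : StrictMono j) (hj' : StrictMono j') (hjj : Sep j j') :
    Γ.EC (Sum.elim (blk d i) (blk d i')) (Sum.elim (blk d j) (blk d j')) := by
  have := (ind_ec (Γ := Γ) hd (sep_append hi hi' hii) (sep_append hj hj' hjj)).comp (pairIdx n γ)
  rwa [blk_pair, blk_pair] at this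

/-- Principle: an invariant equivalence relation with finitely many classes is trivial along
indiscernible sequences. -/
theorem ind_pigeon [Finite γ] {d : ℕ → γ → M} (hd : IsIndiscernible (L := L) d) {n : ℕ}
    {R : (Fin n × γ → M) → (Fin n × γ → M) → Prop}
    (symm : ∀ i j, R i j → R j i) (trans : ∀ i j k, R i j → R j k → R i k)
    {K : Type*} [Finite K] (col : (Fin n × γ → M) → K) (hcol : ∀ i j, col i = col j → R i j)
    (inv : ∀ i i' j j', Γ.EC (Sum.elim i i') (Sum.elim j j') → R i i' → R j j')
    {i j : Fin n → ℕ} (hi : StrictMono i) (hj : StrictMono j) : R (blk d i) (blk d j) :=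
  far_pigeon (R := fun i j => R (blk d i) (blk d j)) (fun _ _ => symm _ _) (fun _ _ _ => trans _ _ _)
    (fun i => col (blk d i)) (fun _ _ => hcol _ _)
    (fun _ _ _ _ h1 h2 h3 h4 h5 h6 => inv _ _ _ _ (ind_ec_pair hd h1 h2 h5 h3 h4 h6)) i j hi hj

end IndSec

section GoodSec

variable {M : Type w} [L.Structure M] [Nonempty M] {C : Type} [Finite C] (Γ : Ctx L M C)
variable {ι κ X Y γ : Type*}

theorem to_fin [Finite ι] (d : ι → M) {S : (X ⊕ ι → M) → Prop} (hS : FD L S) :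
    ∃ (m : ℕ) (v : ι ≃ Fin m) (S' : (X ⊕ Fin m → M) → Prop), FD L S' ∧
      ∀ (x : X → M) (d : ι → M), S (Sum.elim x d) ↔ S' (Sum.elim x (d ∘ v.symm)) := by
  obtain ⟨m, ⟨v⟩⟩ := Finite.exists_equiv_fin ι
  refine ⟨m, v, _, hS.comp (Sum.map id v), fun x d => iff_of_eq ?_⟩
  congr 1
  funext t
  rcases t with t | t <;> simp

/-- Filters generated by definable sets, invariant over the imaginary tuple. -/
structure Ctx.Good (F : Filter (X → M)) : Prop where
  ne : F.NeBot
  gen : ∀ s ∈ F, ∃ (m : ℕ) (d : Fin m → M) (S : (X ⊕ Fin m → M) → Prop), FD L S ∧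
    (∀ᶠ x in F, S (Sum.elim x d)) ∧ ∀ x, S (Sum.elim x d) → x ∈ s
  inv : ∀ (m : ℕ) (d d' : Fin m → M) (S : (X ⊕ Fin m → M) → Prop), FD L S → Γ.EC d d' →
    (∀ᶠ x in F, S (Sum.elim x d)) → ∀ᶠ x in F, S (Sum.elim x d')

variable {Γ}

theorem Ctx.Good.inv' {F : Filter (X → M)} (hF : Γ.Good F) [Finite ι] {d d' : ι → M}
    {S : (X ⊕ ι → M) → Prop} (hS : FD L S) (h : Γ.EC d d')
    (hd : ∀ᶠ x in F, S (Sum.elim x d)) : ∀ᶠ x in F, S (Sum.elim x d') := by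
  obtain ⟨m, v, S', hS', hh⟩ := to_fin d hS
  simp only [hh] at hd ⊢
  exact hF.inv m _ _ S' hS' (h.comp v.symm) hd

variable (Γ)

/-- The filter of the type of `a` over the imaginary tuple. -/
def Ctx.F0 (a : X → M) : Filter (X → M) where
  sets := {s | ∃ U : (X ⊕ C → M) → Prop, FD L U ∧ U (Sum.elim a Γ.c) ∧
    ∀ x, Γ.hat U (Sum.elim x Γ.c) → x ∈ s}
  univ_sets := ⟨fun _ => True, FD.true, trivial, fun _ _ => trivial⟩
  sets_of_superset := by
    rintro s t ⟨U, h1, h2, h3⟩ hst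
    exact ⟨U, h1, h2, fun x hx => hst (h3 x hx)⟩
  inter_sets := by
    rintro s t ⟨U, h1, h2, h3⟩ ⟨U', h1', h2', h3'⟩
    refine ⟨_, h1.and h1', ⟨h2, h2'⟩, ?_⟩
    rintro x ⟨z, hz1, hz2, hz3⟩
    exact ⟨h3 x ⟨z, hz1, hz2⟩, h3' x ⟨z, hz1, hz3⟩⟩

variable {Γ}

theorem Ctx.F0_mem {a : X → M} {U : (X ⊕ C → M) → Prop} (hU : FD L U) (ha : U (Sum.elim a Γ.c)) :
    ∀ᶠ x in Γ.F0 a, ∃ z, Γ.Er Γ.c z ∧ U (Sum.elim x z) :=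
  ⟨U, hU, ha, fun _ h => h⟩

theorem Ctx.F0_good (a : X → M) : Γ.Good (Γ.F0 a) where
  ne := by
    rw [Filter.neBot_iff, Ne, Filter.empty_mem_iff_bot.symm]
    rintro ⟨U, h1, h2, h3⟩
    exact h3 a ⟨Γ.c, Γ.refl _, h2⟩
  gen := by
    rintro s ⟨U, h1, h2, h3⟩
    obtain ⟨m, v, S', hS', hh⟩ := to_fin Γ.c (Γ.fd_hat h1)
    refine ⟨m, Γ.c ∘ v.symm, S', hS', ?_, ?_⟩
    · simp only [← hh]
      exact Ctx.F0_mem h1 h2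
    · simp only [← hh]
      exact h3
  inv := by
    rintro m d d' S hS ⟨z, z', hz, hz', hsame⟩ ⟨U, h1, h2, h3⟩
    refine ⟨U, h1, h2, ?_⟩
    have hfd : FD L (fun w : X ⊕ (Fin m ⊕ C) → M =>
        Γ.hat U (w ∘ Sum.elim Sum.inl (fun t => Sum.inr (Sum.inr t))) →
        S (w ∘ Sum.elim Sum.inl (fun t => Sum.inr (Sum.inl t)))) :=
      ((Γ.fd_hat h1).comp _).imp (hS.comp _)
    have e1 : ∀ (x : X → M) (d : Fin m → M) (z : C → M), (Sum.elim x (Sum.elim d z)) ∘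
        Sum.elim Sum.inl (fun t => Sum.inr (Sum.inr t)) = Sum.elim x z := by
      intro x d z
      funext t
      rcases t with t | t <;> rfl
    have e2 : ∀ (x : X → M) (d : Fin m → M) (z : C → M), (Sum.elim x (Sum.elim d z)) ∘
        Sum.elim Sum.inl (fun t => Sum.inr (Sum.inl t)) = Sum.elim x d := by
      intro x d z
      funext t
      rcases t with t | t <;> rfl
    have h4 := hsame _ hfd.all (by
      intro x
      rw [e1, e2]
      rintro ⟨y, hy1, hy2⟩
      exact h3 x ⟨y, Γ.trans hz hy1, hy2⟩)
    rintro x ⟨y, hy1, hy2⟩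
    have h5 := h4 x
    rw [e1, e2] at h5
    exact h5 ⟨y, Γ.trans (Γ.symm hz') hy1, hy2⟩

variable (Γ)

/-- Minimal good filters. -/
def Ctx.Mini (F : Filter (X → M)) : Prop :=
  Γ.Good F ∧ ∀ F', Γ.Good F' → F' ≤ F → F ≤ F'

variable {Γ}

theorem Ctx.exists_mini {G : Filter (X → M)} (hG : Γ.Good G) : ∃ F, F ≤ G ∧ Γ.Mini F := by
  obtain ⟨F, hGF, hmax⟩ := zorn_le_nonempty₀ (α := (Filter (X → M))ᵒᵈ)
    {F | Γ.Good (OrderDual.ofDual F)} (by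
      intro c hc hch y hy
      let U : Filter (X → M) :=
        { sets := {s | ∃ F ∈ c, s ∈ OrderDual.ofDual F}
          univ_sets := ⟨y, hy, Filter.univ_mem⟩
          sets_of_superset := by
            rintro s t ⟨F, hF, hs⟩ hst
            exact ⟨F, hF, Filter.mem_of_superset hs hst⟩
          inter_sets := by
            rintro s t ⟨F, hF, hs⟩ ⟨F', hF', ht⟩
            rcases hch.total hF hF' with h | h
            · exact ⟨F', hF', Filter.inter_mem (h hs) ht⟩
            · exact ⟨F, hF, Filter.inter_mem hs (h ht)⟩ }
      refine ⟨OrderDual.toDual U, ?_, ?_⟩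
      · refine ⟨?_, ?_, ?_⟩
        · rw [Filter.neBot_iff, Ne, Filter.empty_mem_iff_bot.symm]
          rintro ⟨F, hF, h⟩
          have := (hc hF).ne
          exact Filter.empty_notMem _ h
        · rintro s ⟨F, hF, hs⟩
          obtain ⟨m, d, S, h1, h2, h3⟩ := (hc hF).gen s hs
          exact ⟨m, d, S, h1, ⟨F, hF, h2⟩, h3⟩
        · rintro m d d' S hS hE ⟨F, hF, h⟩
          exact ⟨F, hF, (hc hF).inv m d d' S hS hE h⟩
      · intro F hF s hs
        exact ⟨F, hF, hs⟩) (OrderDual.toDual G) hG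
  refine ⟨OrderDual.ofDual F, hGF, hmax.prop, fun F' hF' hle => ?_⟩
  exact hmax.le_of_ge (y := OrderDual.toDual F') hF' hle

theorem Ctx.Mini.cover {F : Filter (X → M)} (hF : Γ.Mini F) {m : ℕ} {χ : (X ⊕ Fin m → M) → Prop}
    (hχ : FD L χ) (f : Fin m → M) (hpos : ¬ ∀ᶠ x in F, ¬ χ (Sum.elim x f)) :
    ∃ (J : Type) (_ : Finite J) (g : J → Fin m → M), (∀ j, Γ.EC f (g j)) ∧
      ∀ᶠ x in F, ∃ j, χ (Sum.elim x (g j)) := by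
  by_contra hcon
  let G : Filter (X → M) :=
    { sets := {s | ∃ (J : Type) (_ : Finite J) (g : J → Fin m → M), (∀ j, Γ.EC f (g j)) ∧
        ∀ᶠ x in F, (∀ j, ¬ χ (Sum.elim x (g j))) → x ∈ s}
      univ_sets := ⟨Empty, inferInstance, fun j => j.elim, fun j => j.elim, by simp⟩
      sets_of_superset := by
        rintro s t ⟨J, hJ, g, h1, h2⟩ hst
        exact ⟨J, hJ, g, h1, h2.mono fun x hx hx' => hst (hx hx')⟩
      inter_sets := by
        rintro s t ⟨J, hJ, g, h1, h2⟩ ⟨J', hJ', g', h1', h2'⟩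
        refine ⟨J ⊕ J', inferInstance, Sum.elim g g', ?_, ?_⟩
        · rintro (j | j)
          · exact h1 j
          · exact h1' j
        · filter_upwards [h2, h2'] with x hx hx' hh
          exact ⟨hx fun j => hh (Sum.inl j), hx' fun j => hh (Sum.inr j)⟩ }
  have hGF : G ≤ F := fun s hs => ⟨Empty, inferInstance, fun j => j.elim, fun j => j.elim,
    Filter.mem_of_superset hs fun x hx _ => hx⟩
  have hGmem : ∀ᶠ x in G, ¬ χ (Sum.elim x f) :=
    ⟨Unit, inferInstance, fun _ => f, fun _ => Ctx.EC.refl f, Filter.Eventually.of_forall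
      fun x hx => hx ()⟩
  have hGood : Γ.Good G := by
    refine ⟨?_, ?_, ?_⟩
    · rw [Filter.neBot_iff, Ne, Filter.empty_mem_iff_bot.symm]
      rintro ⟨J, hJ, g, h1, h2⟩
      refine hcon ⟨J, hJ, g, h1, h2.mono fun x hx => ?_⟩
      by_contra! hh
      exact hx hh
    · rintro s ⟨J, hJ, g, h1, h2⟩
      obtain ⟨n, d, S, hS, hS1, hS2⟩ := hF.1.gen _ h2
      have hfd : FD L (fun w : X ⊕ (Fin n ⊕ (J × Fin m)) → M =>
          S (w ∘ Sum.map id Sum.inl) ∧ ∀ j, ¬ χ (w ∘ Sum.map id (fun t => Sum.inr (j, t)))) :=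
        (hS.comp _).and (FD.forall_finite fun j => (hχ.comp _).not)
      obtain ⟨n', v, S', hS', hh⟩ := to_fin (Sum.elim d fun p : J × Fin m => g p.1 p.2) hfd
      have hh' : ∀ x, S' (Sum.elim x ((Sum.elim d fun p : J × Fin m => g p.1 p.2) ∘ v.symm)) ↔
          S (Sum.elim x d) ∧ ∀ j, ¬ χ (Sum.elim x (g j)) := by
        intro x
        rw [← hh]
        simp only [Sum.elim_comp_map, Function.comp_id, Sum.elim_comp_inl]
        rfl
      refine ⟨n', (Sum.elim d fun p : J × Fin m => g p.1 p.2) ∘ v.symm, S', hS', ?_, ?_⟩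
      · simp only [hh']
        refine ⟨J, hJ, g, h1, hS1.mono fun x hx hx' => ⟨hx, hx'⟩⟩
      · intro x hx
        rw [hh'] at hx
        exact hS2 x hx.1 hx.2
    · rintro n d d' S hS hE ⟨J, hJ, g, h1, h2⟩
      obtain ⟨g', hg'⟩ := hE.ext (fun p : J × Fin m => g p.1 p.2)
      have hfd : FD L (fun w : X ⊕ ((J × Fin m) ⊕ Fin n) → M =>
          (∀ j, ¬ χ (w ∘ Sum.map id (fun t => Sum.inl (j, t)))) → S (w ∘ Sum.map id Sum.inr)) :=
        (FD.forall_finite fun j => (hχ.comp _).not).imp (hS.comp _)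
      have h3 := hF.1.inv' hfd hg' (by
        filter_upwards [h2] with x hx
        simp only [Sum.elim_comp_map, Function.comp_id, Sum.elim_comp_inr]
        exact hx)
      refine ⟨J, hJ, fun j t => g' (j, t), fun j => (h1 j).trans ?_, ?_⟩
      · exact hg'.comp (fun t => Sum.inl (j, t))
      · filter_upwards [h3] with x hx
        simp only [Sum.elim_comp_map, Function.comp_id, Sum.elim_comp_inr] at hx
        exact hx
  exact hpos (hF.2 G hGood hGF hGmem)

theorem Ctx.Good.isolate {F : Filter (X → M)} (hF : Γ.Good F) [Countable X] [Finite κ]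
    {φ : (X ⊕ κ → M) → Prop} (hφ : FD L φ) : ∃ (m : ℕ) (χ : (X ⊕ Fin m → M) → Prop) (f : Fin m → M),
      FD L χ ∧ (¬ ∀ᶠ x in F, ¬ χ (Sum.elim x f)) ∧ ∀ b : κ → M,
        (∀ᶠ x in F, χ (Sum.elim x f) → φ (Sum.elim x b)) ∨
        (∀ᶠ x in F, χ (Sum.elim x f) → ¬ φ (Sum.elim x b)) := by
  classical
  have hne := hF.ne
  let P : ℕ → Prop := fun n => ∃ (m : ℕ) (χ : (X ⊕ Fin m → M) → Prop) (f : Fin m → M),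
    FD L χ ∧ (¬ ∀ᶠ x in F, ¬ χ (Sum.elim x f)) ∧
    ¬ Tree (fun (x : X → M) (y : κ → M) => φ (Sum.elim x y)) n {x | χ (Sum.elim x f)} univ
  have hP : ∃ n, P n := by
    obtain ⟨N, hN⟩ := tree_bound Γ.hO Γ.hs hφ
    refine ⟨N, 0, fun _ => True, Fin.elim0, FD.true, by simp [hne.ne], fun h => hN ?_⟩
    exact h.mono (Set.subset_univ _) le_rfl
  obtain ⟨m, χ, f, hχ, hpos, hT⟩ := Nat.find_spec hP
  refine ⟨m, χ, f, hχ, hpos, fun b => ?_⟩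
  rcases hn : Nat.find hP with _ | k
  · rw [hn] at hT
    exfalso
    refine hpos (Filter.Eventually.of_forall fun x hx => hT ⟨x, hx⟩)
  rw [hn] at hT
  have hk : ¬ P k := Nat.find_min hP (by omega)
  have step : ∀ φ' : (X ⊕ κ → M) → Prop, FD L φ' →
      ¬ Tree (fun (x : X → M) (y : κ → M) => φ (Sum.elim x y)) k
        ({x | χ (Sum.elim x f)} ∩ {x | φ' (Sum.elim x b)}) univ →
      ∀ᶠ x in F, χ (Sum.elim x f) → ¬ φ' (Sum.elim x b) := by
    intro φ' hφ' ht
    by_contra hcon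
    apply hk
    have hfd : FD L (fun w : X ⊕ (Fin m ⊕ κ) → M => χ (w ∘ Sum.map id Sum.inl) ∧
        φ' (w ∘ Sum.map id Sum.inr)) := (hχ.comp _).and (hφ'.comp _)
    obtain ⟨n', v, S', hS', hh⟩ := to_fin (Sum.elim f b) hfd
    have hh' : ∀ x, S' (Sum.elim x (Sum.elim f b ∘ v.symm)) ↔
        χ (Sum.elim x f) ∧ φ' (Sum.elim x b) := by
      intro x
      rw [← hh]
      simp only [Sum.elim_comp_map, Function.comp_id, Sum.elim_comp_inl, Sum.elim_comp_inr]
    refine ⟨n', S', Sum.elim f b ∘ v.symm, hS', ?_, ?_⟩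
    · simp only [hh']
      simpa only [not_and] using hcon
    · simp only [hh']
      exact ht
  by_cases h1 : Tree (fun (x : X → M) (y : κ → M) => φ (Sum.elim x y)) k
        ({x | χ (Sum.elim x f)} ∩ {x | φ (Sum.elim x b)}) univ
  · left
    have := step _ hφ.not (fun h2 => hT ⟨b, trivial, h1, h2⟩)
    simpa only [not_not] using this
  · right
    exact step φ hφ h1

end GoodSec

section IsolSec

variable {M : Type w} [L.Structure M] [Nonempty M] {C : Type} [Finite C] (Γ : Ctx L M C)
variable {ι κ X Y γ : Type*}

/-- Isolation data for a formula relative to a filter. -/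
structure Ctx.Isol (F : Filter (X → M)) (φ : (X ⊕ κ → M) → Prop) where
  m : ℕ
  χ : (X ⊕ Fin m → M) → Prop
  f : Fin m → M
  fd : FD L χ
  dich : ∀ f', Γ.EC f f' → ∀ b : κ → M, (∀ᶠ x in F, χ (Sum.elim x f') → φ (Sum.elim x b)) ∨
        (∀ᶠ x in F, χ (Sum.elim x f') → ¬ φ (Sum.elim x b))
  pos : ∀ f', Γ.EC f f' → ¬ ∀ᶠ x in F, ¬ χ (Sum.elim x f')
  J : Type
  fin : Finite J
  g : J → Fin m → M
  hg : ∀ j, Γ.EC f (g j)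
  cov : ∀ᶠ x in F, ∃ j, χ (Sum.elim x (g j))

variable {Γ}

theorem ev_pair_inv {F : Filter (X → M)} (hF : Γ.Good F) [Finite ι] [Finite κ]
    {χ : (X ⊕ ι → M) → Prop} {φ : (X ⊕ κ → M) → Prop} (hχ : FD L χ) (hφ : FD L φ)
    {f f' : ι → M} {b b' : κ → M} (h : Γ.EC (Sum.elim f b) (Sum.elim f' b'))
    (hx : ∀ᶠ x in F, χ (Sum.elim x f) → φ (Sum.elim x b)) :
    ∀ᶠ x in F, χ (Sum.elim x f') → φ (Sum.elim x b') := by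
  have hfd : FD L (fun w : X ⊕ (ι ⊕ κ) → M => χ (w ∘ Sum.map id Sum.inl) →
        φ (w ∘ Sum.map id Sum.inr)) := (hχ.comp _).imp (hφ.comp _)
  have := hF.inv' hfd h
  simp only [Sum.elim_comp_map, Function.comp_id, Sum.elim_comp_inl, Sum.elim_comp_inr] at this
  exact this hx

theorem Ctx.Mini.isol {F : Filter (X → M)} (hF : Γ.Mini F) [Countable X] [Finite κ]
    {φ : (X ⊕ κ → M) → Prop} (hφ : FD L φ) : Nonempty (Γ.Isol F φ) := by
  obtain ⟨m, χ, f, hχ, hpos, hd⟩ := hF.1.isolate hφ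
  obtain ⟨J, hJ, g, hg, hcov⟩ := hF.cover hχ f hpos
  refine ⟨⟨m, χ, f, hχ, ?_, ?_, J, hJ, g, hg, hcov⟩⟩
  · intro f' hf' b
    obtain ⟨b', hb'⟩ := hf'.symm.ext b
    have hb2 : Γ.EC (Sum.elim f b') (Sum.elim f' b) := by
      have := hb'.symm.comp Sum.swap
      convert this using 1 <;>
      · funext t
        rcases t with t | t <;> rfl
    rcases hd b' with h | h
    · exact Or.inl (ev_pair_inv hF.1 hχ hφ hb2 h)
    · exact Or.inr (ev_pair_inv hF.1 hχ hφ.not hb2 h)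
  · intro f' hf' h
    exact hpos (hF.1.inv' hχ.not hf'.symm h)

variable {F : Filter (X → M)} {φ : (X ⊕ κ → M) → Prop}

/-- The induced definition. -/
def Ctx.Isol.D (I : Γ.Isol F φ) (f' : Fin I.m → M) (b : κ → M) : Prop :=
  ∀ᶠ x in F, I.χ (Sum.elim x f') → φ (Sum.elim x b)

/-- The induced equivalence relation. -/
def Ctx.Isol.rel (I : Γ.Isol F φ) (b b' : κ → M) : Prop :=
  ∀ f', Γ.EC I.f f' → (I.D f' b ↔ I.D f' b')

theorem Ctx.Isol.D_inv [Finite κ] (I : Γ.Isol F φ) (hF : Γ.Good F) (hφ : FD L φ)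
    {f f' : Fin I.m → M} {b b' : κ → M} (h : Γ.EC (Sum.elim f b) (Sum.elim f' b')) :
    I.D f b ↔ I.D f' b' :=
  ⟨ev_pair_inv hF I.fd hφ h, ev_pair_inv hF I.fd hφ h.symm⟩

theorem Ctx.Isol.rel_symm (I : Γ.Isol F φ) {b b' : κ → M} (h : I.rel b b') : I.rel b' b :=
  fun f' hf' => (h f' hf').symm

theorem Ctx.Isol.rel_trans (I : Γ.Isol F φ) {b b' b'' : κ → M} (h : I.rel b b')
    (h' : I.rel b' b'') : I.rel b b'' :=
  fun f' hf' => (h f' hf').trans (h' f' hf')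

theorem Ctx.Isol.rel_inv [Finite κ] (I : Γ.Isol F φ) (hF : Γ.Good F) (hφ : FD L φ)
    {b1 b2 b1' b2' : κ → M} (h : Γ.EC (Sum.elim b1 b2) (Sum.elim b1' b2')) (hr : I.rel b1 b2) :
    I.rel b1' b2' := by
  intro f' hf'
  obtain ⟨f0, hf0⟩ := h.symm.ext f'
  have h1 : Γ.EC (Sum.elim f' b1') (Sum.elim f0 b1) := by
    have := hf0.comp (Sum.map id Sum.inl)
    simpa only [Sum.elim_comp_map, Function.comp_id, Sum.elim_comp_inl] using this
  have h2 : Γ.EC (Sum.elim f' b2') (Sum.elim f0 b2) := by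
    have := hf0.comp (Sum.map id Sum.inr)
    simpa only [Sum.elim_comp_map, Function.comp_id, Sum.elim_comp_inr] using this
  have h3 : Γ.EC f' f0 := h1.comp Sum.inl
  rw [I.D_inv hF hφ h1, I.D_inv hF hφ h2]
  exact hr f0 (hf'.trans h3)

/-- Colouring with finitely many colours. -/
def Ctx.Isol.col (I : Γ.Isol F φ) (b : κ → M) : I.J → Prop := fun j => I.D (I.g j) b

theorem Ctx.Isol.hcol (I : Γ.Isol F φ) {b b' : κ → M} (h : I.col b = I.col b') : I.rel b b' := by
  intro f' hf'
  have := I.fin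
  have h1 : ∃ j, ¬ ∀ᶠ x in F, I.χ (Sum.elim x f') → ¬ I.χ (Sum.elim x (I.g j)) := by
    by_contra! hcon
    apply I.pos f' hf'
    filter_upwards [I.cov, Filter.eventually_all.2 hcon] with x ⟨j, hj⟩ hx hx'
    exact hx j hx' hj
  obtain ⟨j, hj⟩ := h1
  have h2 : ∀ b, I.D f' b ↔ I.D (I.g j) b := by
    intro b
    constructor
    · intro h
      by_contra hn
      have := (I.dich _ (I.hg j) b).resolve_left hn
      apply hj
      filter_upwards [h, this] with x hx hx' h1 h2
      exact hx' h2 (hx h1)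
    · intro h
      by_contra hn
      have := (I.dich _ hf' b).resolve_left hn
      apply hj
      filter_upwards [h, this] with x hx hx' h1 h2
      exact hx' h1 (hx h2)
  rw [h2, h2]
  have := congrFun h j
  exact iff_of_eq this

theorem Ctx.Isol.ultra (I : Γ.Isol F φ) {P : Ultrafilter (X → M)} (hP : (P : Filter (X → M)) ≤ F) :
    ∃ f', Γ.EC I.f f' ∧ ∀ᶠ x in (P : Filter (X → M)), I.χ (Sum.elim x f') := by
  have := I.fin
  have h : ∀ᶠ x in (P : Filter (X → M)), ∃ j, I.χ (Sum.elim x (I.g j)) := hP I.cov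
  rw [Ultrafilter.eventually_exists_iff] at h
  obtain ⟨j, hj⟩ := h
  exact ⟨_, I.hg j, hj⟩

theorem Ctx.Isol.ultra_iff (I : Γ.Isol F φ) {P : Ultrafilter (X → M)}
    (hP : (P : Filter (X → M)) ≤ F) {f' : Fin I.m → M} (hf' : Γ.EC I.f f')
    (hχ : ∀ᶠ x in (P : Filter (X → M)), I.χ (Sum.elim x f')) (b : κ → M) :
    (∀ᶠ x in (P : Filter (X → M)), φ (Sum.elim x b)) ↔ I.D f' b := by
  constructor
  · intro h
    by_contra hn
    have h1 := hP ((I.dich _ hf' b).resolve_left hn)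
    obtain ⟨x, hx1, hx2, hx3⟩ := (hχ.and (h.and h1)).exists
    exact hx3 hx1 hx2
  · intro h
    filter_upwards [hχ, hP h] with x hx hx'
    exact hx' hx

theorem Ctx.Isol.pos_ultra (I : Γ.Isol F φ) {f' : Fin I.m → M} (hf' : Γ.EC I.f f') :
    ∃ P : Ultrafilter (X → M), (P : Filter (X → M)) ≤ F ∧
      ∀ᶠ x in (P : Filter (X → M)), I.χ (Sum.elim x f') := by
  have hne : (F ⊓ Filter.principal {x | I.χ (Sum.elim x f')}).NeBot := by
    rw [Filter.inf_principal_neBot_iff]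
    intro U hU
    by_contra hcon
    apply I.pos f' hf'
    filter_upwards [hU] with x hx hx'
    exact hcon ⟨x, hx, hx'⟩
  refine ⟨Ultrafilter.of (F ⊓ Filter.principal {x | I.χ (Sum.elim x f')}),
    (Ultrafilter.of_le _).trans inf_le_left, ?_⟩
  have := (Ultrafilter.of_le (F ⊓ Filter.principal {x | I.χ (Sum.elim x f')})).trans inf_le_right
  exact this (Filter.mem_principal_self _)

/-- Lascar invariance. -/
theorem lascar (hF : Γ.Mini F) [Countable X] [Finite γ] {P : Ultrafilter (X → M)}
    (hP : (P : Filter (X → M)) ≤ F) {d : ℕ → γ → M} (hd : IsIndiscernible (L := L) d)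
    {n : ℕ} {i j : Fin n → ℕ} (hi : StrictMono i) (hj : StrictMono j)
    {φ : (X ⊕ (Fin n × γ) → M) → Prop} (hφ : FD L φ) :
    (∀ᶠ x in (P : Filter (X → M)), φ (Sum.elim x (blk d i))) ↔
      ∀ᶠ x in (P : Filter (X → M)), φ (Sum.elim x (blk d j)) := by
  obtain ⟨I⟩ := hF.isol hφ
  obtain ⟨f', hf', hχ⟩ := I.ultra hP
  rw [I.ultra_iff hP hf' hχ, I.ultra_iff hP hf' hχ]
  have := I.fin
  exact ind_pigeon (Γ := Γ) hd (R := I.rel) (fun _ _ => I.rel_symm) (fun _ _ _ => I.rel_trans) I.col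
    (fun _ _ => I.hcol) (fun _ _ _ _ => I.rel_inv hF.1 hφ) hi hj f' hf'

end IsolSec

section SymSec

variable {M : Type w} [L.Structure M] [Nonempty M] {C : Type} [Finite C] {Γ : Ctx L M C}
variable {ι ι' κ X Y α β γ : Type*}

/-- `y` realizes the restriction of the ultrafilter `Q` to the parameters `d`. -/
def Rz (L : FirstOrder.Language.{u, v}) {M : Type w} [L.Structure M] {X ι : Type*}
    (Q : Ultrafilter (X → M)) (y : X → M) (d : ι → M) : Prop :=
  ∀ S : (X ⊕ ι → M) → Prop, FD L S → (∀ᶠ t in (Q : Filter (X → M)), S (Sum.elim t d)) →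
    S (Sum.elim y d)

theorem exists_rz (hO : OSat L M) [Countable X] [Finite ι] (Q : Ultrafilter (X → M)) (d : ι → M) :
    ∃ y, Rz L Q y d := exists_real hO d (Q : Filter (X → M)) Q.neBot

theorem Rz.comp {Q : Ultrafilter (X → M)} {y : X → M} {d : ι → M} (h : Rz L Q y d) (g : ι' → ι) :
    Rz L Q y (d ∘ g) := by
  intro S hS hev
  have := h _ (hS.comp (Sum.map id g))
  simp only [Sum.elim_comp_map, Function.comp_id] at this
  exact this hev

theorem Rz.iff {Q : Ultrafilter (X → M)} {y : X → M} {d : ι → M} (h : Rz L Q y d)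
    {S : (X ⊕ ι → M) → Prop} (hS : FD L S) :
    S (Sum.elim y d) ↔ ∀ᶠ t in (Q : Filter (X → M)), S (Sum.elim t d) := by
  constructor
  · intro hy
    by_contra hn
    rw [← Ultrafilter.eventually_not] at hn
    exact h _ hS.not hn hy
  · exact h S hS

theorem Rz.same {Q : Ultrafilter (X → M)} {y y' : X → M} {d : ι → M} (h : Rz L Q y d)
    (h' : Rz L Q y' d) : Same L (Sum.elim y d) (Sum.elim y' d) := by
  intro S hS hy
  rw [h.iff hS] at hy
  exact h' S hS hy

theorem Rz.ec [Finite X] {Q : Ultrafilter (X → M)} {a y : X → M} (hQ : (Q : Filter (X → M)) ≤ Γ.F0 a)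
    (h : Rz L Q y Γ.c) : Γ.EC a y := by
  refine Ctx.EC.of_inv fun S hS ha => ?_
  exact h _ (Γ.fd_hat hS) (hQ (Ctx.F0_mem hS ha))

theorem ev_of_F0 {Q : Filter (X → M)} {a : X → M} (hQ : Q ≤ Γ.F0 a)
    {S : (X → M) → Prop} (hS : FD L S) (ha : S a) : ∀ᶠ x in Q, S x := by
  have h1 := hQ (Ctx.F0_mem (Γ := Γ) (hS.comp (Sum.inl : X → X ⊕ C)) ha)
  filter_upwards [h1] with x hx
  obtain ⟨z, -, hz⟩ := hx
  exact hz

theorem Rz.same0 {Q : Ultrafilter (X → M)} {a y : X → M} (hQ : (Q : Filter (X → M)) ≤ Γ.F0 a)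
    {d : ι → M} (h : Rz L Q y d) : Same L a y := by
  intro S hS ha
  exact h _ (hS.comp (Sum.inl : X → X ⊕ ι)) (ev_of_F0 hQ hS ha)

/-- The sequence part of a tuple. -/
def sq (x : (ℕ × α) ⊕ β → M) : ℕ → α → M := fun n t => x (Sum.inl (n, t))

/-- Index map of a block. -/
def bix {n : ℕ} (α β : Type*) (i : Fin n → ℕ) : Fin n × α → (ℕ × α) ⊕ β :=
  fun p => Sum.inl (i p.1, p.2)

theorem comp_bix {n : ℕ} (x : (ℕ × α) ⊕ β → M) (i : Fin n → ℕ) : x ∘ bix α β i = blk (sq x) i := rfl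

theorem ind_of_same_sq {x x' : (ℕ × α) ⊕ β → M} (h : Same L x x')
    (hx : IsIndiscernible (L := L) (sq x)) : IsIndiscernible (L := L) (sq x') := by
  refine ind_of_same fun n i j hi hj => ?_
  have h1 := h.comp (bix α β i)
  have h2 := h.comp (bix α β j)
  exact h1.symm.trans ((ind_same hx hi hj).trans h2)

/-- A type all of whose independent extensions are finitely coloured: a point with constant
colour along the generic. -/
theorem exists_base [Finite κ] (Q : Ultrafilter (κ → M)) {K : Type*} [Finite K]
    {R : (κ → M) → (κ → M) → Prop} (col : (κ → M) → K) (hcol : ∀ i j, col i = col j → R i j)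
    (inv : ∀ i i' j j', Γ.EC (Sum.elim i i') (Sum.elim j j') → R i i' → R j j') :
    ∃ y, Rz L Q y Γ.c ∧ ∀ y', Rz L Q y' (Sum.elim y Γ.c) → R y y' := by
  classical
  obtain ⟨y, hy1, hy2⟩ := exists_seq_of_forall_finset_exists (fun y : κ → M => Rz L Q y Γ.c)
    (fun y y' => Rz L Q y' (Sum.elim y Γ.c)) (by
      intro s hs
      obtain ⟨y, hy⟩ := exists_rz Γ.hO Q (Sum.elim (fun p : s × κ => p.1.1 p.2) Γ.c)
      refine ⟨y, hy.comp Sum.inr, fun x hx => ?_⟩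
      have := hy.comp (Sum.map (fun t : κ => ((⟨x, hx⟩ : s), t)) id)
      rw [Sum.elim_comp_map] at this
      exact this)
  have main : ∀ m n, m < n → col (y m) = col (y n) →
      ∃ y, Rz L Q y Γ.c ∧ ∀ y', Rz L Q y' (Sum.elim y Γ.c) → R y y' := by
    intro m n hmn he
    refine ⟨y m, hy1 m, fun y' hy' => inv _ _ _ _ ?_ (hcol _ _ he)⟩
    refine ⟨Γ.c, Γ.c, Γ.refl _, Γ.refl _, ?_⟩
    have := ((hy2 m n hmn).same hy').comp (Sum.elim (Sum.elim (fun t => Sum.inr (Sum.inl t)) Sum.inl)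
      (fun t => Sum.inr (Sum.inr t)))
    convert this using 1 <;>
    · funext t
      rcases t with (t | t) | t <;> rfl
  obtain ⟨m, n, hne, he⟩ := Finite.exists_ne_map_eq_of_infinite fun m => col (y m)
  rcases lt_or_gt_of_ne hne with h | h
  · exact main m n h he
  · exact main n m h he.symm

theorem lemD [Countable α] [Finite α] [Countable β] [Finite κ]
    {a0 : (ℕ × α) ⊕ β → M} (ha0 : IsIndiscernible (L := L) (sq a0))
    {F : Filter ((ℕ × α) ⊕ β → M)} (hF : Γ.Mini F) (hF0 : F ≤ Γ.F0 a0)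
    {P : Ultrafilter ((ℕ × α) ⊕ β → M)} (hP : (P : Filter ((ℕ × α) ⊕ β → M)) ≤ F) {n : ℕ} {i i' : Fin n → ℕ}
    (hi : StrictMono i) (hi' : StrictMono i') {φ : ((Fin n × α) ⊕ κ → M) → Prop} (hφ : FD L φ)
    (b : κ → M) (h : ∀ᶠ x in (P : Filter ((ℕ × α) ⊕ β → M)), φ (Sum.elim (blk (sq x) i) b)) :
    ∀ᶠ x in (P : Filter ((ℕ × α) ⊕ β → M)), φ (Sum.elim (blk (sq x) i') b) := by
  classical
  by_contra hn
  rw [← Ultrafilter.eventually_not] at hn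
  let Φ : (((ℕ × α) ⊕ β) ⊕ κ → M) → Prop := fun w =>
    φ (w ∘ Sum.map (bix α β i) id) ∧ ¬ φ (w ∘ Sum.map (bix α β i') id)
  have hΦ : FD L Φ := (hφ.comp _).and (hφ.comp _).not
  have hΦe : ∀ x b, Φ (Sum.elim x b) ↔
      φ (Sum.elim (blk (sq x) i) b) ∧ ¬ φ (Sum.elim (blk (sq x) i') b) := by
    intro x b
    simp only [Φ, Sum.elim_comp_map, Function.comp_id, comp_bix]
  have hPΦ : ∀ᶠ x in (P : Filter ((ℕ × α) ⊕ β → M)), Φ (Sum.elim x b) := by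
    filter_upwards [h, hn] with x h1 h2
    rw [hΦe]
    exact ⟨h1, h2⟩
  obtain ⟨FQ, hFQ0, hFQ⟩ := Ctx.exists_mini (Γ.F0_good b)
  have hFQne := hFQ.1.ne
  let Q : Ultrafilter (κ → M) := Ultrafilter.of FQ
  have hQ : (Q : Filter (κ → M)) ≤ FQ := Ultrafilter.of_le FQ
  obtain ⟨I⟩ := hF.isol hΦ
  have := I.fin
  obtain ⟨fo, hfo, hχ⟩ := I.ultra hP
  rw [I.ultra_iff hP hfo hχ] at hPΦ
  obtain ⟨yo, hyo, hyo'⟩ := exists_base (Γ := Γ) Q (R := I.rel) I.col (fun _ _ => I.hcol)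
    (fun _ _ _ _ => I.rel_inv hF.1 hΦ)
  obtain ⟨fs, hfs⟩ := (hyo.ec (hQ.trans hFQ0)).ext fo
  rw [I.D_inv hF.1 hΦ hfs] at hPΦ
  have hEfs : Γ.EC I.f fs := hfo.trans (hfs.comp Sum.inl)
  obtain ⟨Ps, hPs, hχs⟩ := I.pos_ultra hEfs
  have hPsΦ : ∀ y, I.rel yo y → ∀ᶠ x in (Ps : Filter ((ℕ × α) ⊕ β → M)), Φ (Sum.elim x y) := by
    intro y hy
    rw [I.ultra_iff hPs hEfs hχs]
    exact (hy fs hEfs).1 hPΦ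
  have hQneg : ∀ a : (ℕ × α) ⊕ β → M, IsIndiscernible (L := L) (sq a) →
      ∀ᶠ t in (Q : Filter (κ → M)), φ (Sum.elim (blk (sq a) i) t) → φ (Sum.elim (blk (sq a) i') t) := by
    intro a ha
    have h1 := lascar hFQ hQ ha hi hi' (hφ.comp Sum.swap)
    have hsw : ∀ (t : κ → M) (y : Fin n × α → M), Sum.elim t y ∘ Sum.swap = Sum.elim y t := by
      intro t y
      funext z
      rcases z with z | z <;> rfl
    simp only [hsw] at h1
    by_cases h2 : ∀ᶠ t in (Q : Filter (κ → M)), φ (Sum.elim (blk (sq a) i) t)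
    · filter_upwards [h1.1 h2] with t ht _
      exact ht
    · rw [← Ultrafilter.eventually_not] at h2
      filter_upwards [h2] with t ht ht'
      exact absurd ht' ht
  obtain ⟨f, hf1, hf2⟩ := exists_seq_of_forall_finset_exists
    (fun p : ((ℕ × α) ⊕ β → M) × (κ → M) => IsIndiscernible (L := L) (sq p.1) ∧ I.rel yo p.2 ∧
      ¬ Φ (Sum.elim p.1 p.2))
    (fun p p' => Φ (Sum.elim p'.1 p.2) ∧ ¬ Φ (Sum.elim p.1 p'.2)) (by
      intro s hs
      obtain ⟨a', ha'⟩ := exists_rz Γ.hO Ps (fun p : s × κ => p.1.1.2 p.2)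
      have hind : IsIndiscernible (L := L) (sq a') :=
        ind_of_same_sq (ha'.same0 (hPs.trans hF0)) ha0
      have h1 : ∀ p ∈ s, Φ (Sum.elim a' p.2) := by
        intro p hp
        have := ha'.comp (fun t : κ => ((⟨p, hp⟩ : s), t))
        exact this Φ hΦ (hPsΦ p.2 (hs p hp).2.1)
      let s' : Finset ((ℕ × α) ⊕ β → M) := insert a' (s.image Prod.fst)
      have hs' : ∀ a ∈ s', IsIndiscernible (L := L) (sq a) := by
        intro a ha
        rcases Finset.mem_insert.1 ha with rfl | ha
        · exact hind
        · obtain ⟨p, hp, rfl⟩ := Finset.mem_image.1 ha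
          exact (hs p hp).1
      obtain ⟨b', hb'⟩ := exists_rz Γ.hO Q (Sum.elim (fun p : s' × (Fin n × α) => blk (sq p.1.1) i p.2)
        (Sum.elim (fun p : s' × (Fin n × α) => blk (sq p.1.1) i' p.2) (Sum.elim yo Γ.c)))
      have h2 : ∀ a ∈ s', ¬ Φ (Sum.elim a b') := by
        intro a ha
        rw [hΦe]
        have h3 := hb'.comp (Sum.elim (fun t : Fin n × α => Sum.inl ((⟨a, ha⟩ : s'), t))
          (fun t : Fin n × α => Sum.inr (Sum.inl ((⟨a, ha⟩ : s'), t))))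
        have h4 : Rz L Q b' (Sum.elim (blk (sq a) i) (blk (sq a) i')) := by
          convert h3 using 1
          funext t
          rcases t with t | t <;> rfl
        have hfd : FD L (fun w : κ ⊕ ((Fin n × α) ⊕ (Fin n × α)) → M =>
            φ (w ∘ Sum.elim (fun t => Sum.inr (Sum.inl t)) Sum.inl) →
            φ (w ∘ Sum.elim (fun t => Sum.inr (Sum.inr t)) Sum.inl)) := (hφ.comp _).imp (hφ.comp _)
        have h5 := h4 _ hfd (by
          filter_upwards [hQneg a (hs' a ha)] with t ht
          convert ht using 2 <;>
          · funext t
            rcases t with t | t <;> rfl)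
        rintro ⟨h6, h7⟩
        apply h7
        convert h5 _ using 1
        · funext t
          rcases t with t | t <;> rfl
        · convert h6 using 1
          funext t
          rcases t with t | t <;> rfl
      refine ⟨(a', b'), ⟨hind, hyo' b' (hb'.comp (fun t => Sum.inr (Sum.inr t))), ?_⟩, ?_⟩
      · exact h2 a' (Finset.mem_insert_self _ _)
      · intro p hp
        exact ⟨h1 p hp, h2 _ (Finset.mem_insert_of_mem (Finset.mem_image_of_mem _ hp))⟩)
  refine no_order' Γ.hs hΦ (fun k => (f k).1) (fun k => (f k).2) fun k l => ?_
  rcases lt_trichotomy k l with hkl | rfl | hkl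
  · exact iff_of_false (hf2 k l hkl).2 (by omega)
  · exact iff_of_false (hf1 k).2.2 (by omega)
  · exact iff_of_true (hf2 l k hkl).1 hkl

end SymSec

section Inst

variable {M : Type w} [L.Structure M] [Nonempty M] {k : ℕ} {e : Fin k → Im L M}
variable {ι ι' κ X Y α β γ : Type*}

/-- The context attached to a tuple of algebraic imaginaries. -/
theorem exists_ctx (hO : OSat L M) (hs : Stb L M) (e : Fin k → Im L M)
    (he : ∀ r, InAclEq (L := L) (∅ : Set M) (e r)) :
    ∃ Γ : Ctx L M (ImVars e), ∀ z : ImVars e → M,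
      Γ.Er Γ.c z ↔ IsRep e (fun r t => z ⟨r, t⟩) := by
  classical
  choose c hc using fun r => (e r).isCls
  choose m d φ hd hinv hφ hfin using he
  have hm : ∀ r, ∀ t : Fin (m r), False := fun r t => hd r t
  let rr : (ImVars e → M) → ∀ r, Fin ((e r).n) → M := fun z r t => z ⟨r, t⟩
  let Er : (ImVars e → M) → (ImVars e → M) → Prop := fun z z' =>
    ∀ r, (e r).E.Realize (Sum.elim (rr z r) (rr z' r))
  have hEr : ∀ z, Er (fun q => c q.1 q.2) z ↔ IsRep e (rr z) := by
    intro z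
    refine forall_congr' fun r => ?_
    rw [hc r]
    rfl
  let Psi : (ImVars e → M) → Prop := fun z => ∀ r, (φ r).Realize (Sum.elim (rr z r) (d r))
  let W : ∀ r, Set (Set (Fin (e r).n → M)) := fun r =>
    {D | (∃ a : Fin (e r).n → M, D = {b | (e r).E.Realize (Sum.elim a b)}) ∧
      ∀ a ∈ D, (φ r).Realize (Sum.elim a (d r))}
  let ch : ∀ r, Set (Fin (e r).n → M) → (Fin (e r).n → M) := fun r D =>
    if h : D.Nonempty then h.some else fun _ => Classical.arbitrary M
  let Zf : Set (ImVars e → M) := (fun f : (∀ r, Set (Fin (e r).n → M)) => fun q : ImVars e => ch q.1 (f q.1) q.2) ''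
    (Set.pi Set.univ W)
  refine ⟨{ hO := hO, hs := hs, Er := Er, refl := ?_, symm := ?_, trans := ?_, fdE := ?_,
            c := fun q => c q.1 q.2, Psi := Psi, fdP := ?_, psi := ?_, Zf := Zf, finZ := ?_,
            cov := ?_ }, hEr⟩
  · exact fun z r => (e r).isEqRel.1 _
  · exact fun h r => (e r).isEqRel.2.1 _ _ (h r)
  · exact fun h h' r => (e r).isEqRel.2.2 _ _ _ (h r) (h' r)
  · refine FD.forall_finite fun r => ?_
    refine ((FD.of (e r).E).comp (Sum.map (fun t => (⟨r, t⟩ : ImVars e))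
      (fun t => (⟨r, t⟩ : ImVars e)))).congr fun w => ?_
    refine iff_of_eq (congrArg _ ?_)
    funext t
    rcases t with t | t <;> rfl
  · refine FD.forall_finite fun r => ?_
    refine ((FD.of (φ r)).comp (Sum.elim (fun t => (⟨r, t⟩ : ImVars e))
      (fun t => (hm r t).elim))).congr fun w => ?_
    refine iff_of_eq (congrArg _ ?_)
    funext t
    rcases t with t | t
    · rfl
    · exact (hm r t).elim
  · intro z hz r
    exact hφ r _ ((hEr z).1 hz r)
  · exact (Set.Finite.pi' fun r => hfin r).subset (by intro f hf r; exact hf r trivial) |>.image _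
  · intro z hz
    refine ⟨_, ⟨fun r => {b | (e r).E.Realize (Sum.elim (rr z r) b)}, ?_, rfl⟩, ?_⟩
    · intro r _
      exact ⟨⟨_, rfl⟩, fun a ha => (hinv r _ _ ha).1 (hz r)⟩
    · intro r
      have hne : ({b | (e r).E.Realize (Sum.elim (rr z r) b)} : Set (Fin (e r).n → M)).Nonempty :=
        ⟨_, (e r).isEqRel.1 _⟩
      have h1 := hne.some_mem
      have h2 : ch r {b | (e r).E.Realize (Sum.elim (rr z r) b)} = hne.some := by
        simp only [ch, dif_pos hne]
      change (e r).E.Realize (Sum.elim (rr z r) (ch r {b | (e r).E.Realize (Sum.elim (rr z r) b)}))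
      rw [h2]
      exact h1

variable {Γ : Ctx L M (ImVars e)}

theorem er_of_rep (hΓ : ∀ z : ImVars e → M, Γ.Er Γ.c z ↔ IsRep e (fun r t => z ⟨r, t⟩))
    {c : ∀ r, Fin ((e r).n) → M} (hc : IsRep e c) : Γ.Er Γ.c (fun q => c q.1 q.2) :=
  (hΓ _).2 hc

theorem hat_saturated {S : (ι ⊕ ImVars e → M) → Prop} (d : ι → M) {z z' : ImVars e → M}
    (h : Γ.Er z z') (hz : Γ.hat S (Sum.elim d z)) : Γ.hat S (Sum.elim d z') := by
  obtain ⟨y, hy1, hy2⟩ := hz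
  exact ⟨y, Γ.trans (Γ.symm h) hy1, hy2⟩

theorem type_sub (hΓ : ∀ z : ImVars e → M, Γ.Er Γ.c z ↔ IsRep e (fun r t => z ⟨r, t⟩))
    {d d' : ι → M} (h : Γ.EC d d') :
    typeOverIm (L := L) e d ⊆ typeOverIm (L := L) e d' := by
  rintro φ ⟨hinv, hφ⟩
  refine ⟨hinv, fun c hc => ?_⟩
  obtain ⟨z, hz1, hz2⟩ := h.inv (FD.of φ) ⟨_, er_of_rep hΓ hc, hφ c hc⟩
  exact (hinv d' _ _ ((hΓ z).1 hz1) hc).1 hz2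

theorem type_eq (hΓ : ∀ z : ImVars e → M, Γ.Er Γ.c z ↔ IsRep e (fun r t => z ⟨r, t⟩))
    {d d' : ι → M} (h : Γ.EC d d') : typeOverIm (L := L) e d = typeOverIm (L := L) e d' :=
  (type_sub hΓ h).antisymm (type_sub hΓ h.symm)

theorem ec_of_type (hΓ : ∀ z : ImVars e → M, Γ.Er Γ.c z ↔ IsRep e (fun r t => z ⟨r, t⟩))
    [Finite ι] {d d' : ι → M} (h : typeOverIm (L := L) e d = typeOverIm (L := L) e d') :
    Γ.EC d d' := by
  refine Ctx.EC.of_inv fun S hS hd => ?_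
  obtain ⟨ψ, hψ⟩ := Γ.fd_hat hS
  have h1 : ψ ∈ typeOverIm (L := L) e d := by
    refine ⟨fun x c c' hc hc' => ?_, fun c hc => ?_⟩
    · rw [← hψ, ← hψ]
      have := Γ.trans (Γ.symm (er_of_rep hΓ hc)) (er_of_rep hΓ hc')
      exact ⟨hat_saturated x this, hat_saturated x (Γ.symm this)⟩
    · rw [← hψ]
      exact ⟨Γ.c, Γ.symm (er_of_rep hΓ hc), hd⟩
  rw [h] at h1
  have h2 := h1.2 _ ((hΓ Γ.c).1 (Γ.refl _))
  exact (hψ (Sum.elim d' Γ.c)).2 h2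

theorem ind_of_im (hΓ : ∀ z : ImVars e → M, Γ.Er Γ.c z ↔ IsRep e (fun r t => z ⟨r, t⟩))
    {d : ℕ → γ → M} (h : IsIndiscernibleOverIm (L := L) e d) : IsIndiscernible (L := L) d := by
  intro n i j hi hj φ
  have h1 := h n i j hi hj (φ.relabel Sum.inl) (fun d c c' _ _ => by
    simp only [Formula.realize_relabel, Sum.elim_comp_inl]) _ ((hΓ Γ.c).1 (Γ.refl _))
  simpa only [Formula.realize_relabel, Sum.elim_comp_inl] using h1

theorem mem_range_fun {m : ℕ} {c : Fin m → M} {d : κ → M} (hc : ∀ t, c t ∈ range d) :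
    ∃ g : Fin m → κ, c = d ∘ g := by
  choose g hg using hc
  exact ⟨g, funext fun t => (hg t).symm⟩

theorem indep_ec (hΓ : ∀ z : ImVars e → M, Γ.Er Γ.c z ↔ IsRep e (fun r t => z ⟨r, t⟩))
    [Finite ι] [Finite κ] {a a' : ι → M} {d d' : κ → M}
    (h : Γ.EC (Sum.elim a d) (Sum.elim a' d')) (hi : IndepOverIm (L := L) a (range d) e) :
    IndepOverIm (L := L) a' (range d') e := by
  intro m c hc φ hinv rep hrep hφ hdiv
  obtain ⟨g, rfl⟩ := mem_range_fun hc
  obtain ⟨kk, D, hkk, hD0, hD, hinc⟩ := hdiv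
  obtain ⟨G, hG⟩ := h.symm.ext (fun p : ℕ × (Fin m ⊕ ImVars e) => D p.1 p.2)
  let D' : ℕ → Fin m ⊕ ImVars e → M := fun n t => G (n, t)
  -- the tuple at stage zero
  have hz : ∃ rep' : ImVars e → M, Γ.Er Γ.c rep' ∧ D' 0 = Sum.elim (d ∘ g) rep' ∧
      φ.Realize (Sum.elim a (D' 0)) := by
    have hfd1 : FD L (fun w : (((ℕ × (Fin m ⊕ ImVars e)) ⊕ (ι ⊕ κ)) ⊕ ImVars e) → M =>
        Γ.Er (w ∘ Sum.inr) (w ∘ fun t => Sum.inl (Sum.inl (0, Sum.inr t))) ∧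
        (w ∘ (fun t : Fin m => Sum.inl (Sum.inl (0, Sum.inl t))) =
          w ∘ (fun t : Fin m => Sum.inl (Sum.inr (Sum.inr (g t))))) ∧
        φ.Realize (w ∘ Sum.elim (fun t => Sum.inl (Sum.inr (Sum.inl t)))
          (fun t => Sum.inl (Sum.inl (0, t))))) := by
      refine FD.and ?_ (FD.and (FD.eq _ _) ((FD.of φ).comp _))
      exact Γ.fdE.comp (Sum.elim Sum.inr (fun t => Sum.inl (Sum.inl (0, Sum.inr t))))
    obtain ⟨z, hz0, hz1, hz2, hz3⟩ := hG.inv hfd1 ⟨Γ.c, Γ.refl _, by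
      refine ⟨?_, ?_, ?_⟩
      · have : ((Sum.elim (Sum.elim (fun p : ℕ × (Fin m ⊕ ImVars e) => D p.1 p.2)
          (Sum.elim a' d')) Γ.c) ∘ fun t => Sum.inl (Sum.inl (0, Sum.inr t))) =
            fun q : ImVars e => rep q.1 q.2 := by
          funext t
          exact congrFun hD0 (Sum.inr t)
        rw [this]
        exact er_of_rep hΓ hrep
      · funext t
        exact congrFun hD0 (Sum.inl t)
      · convert hφ using 1
        funext t
        rcases t with t | t
        · rfl
        · exact congrFun hD0 t⟩
    refine ⟨fun t => D' 0 (Sum.inr t), Γ.trans hz0 hz1, ?_, ?_⟩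
    · funext t
      rcases t with t | t
      · exact congrFun hz2 t
      · rfl
    · convert hz3 using 1
      funext t
      rcases t with t | t <;> rfl
  obtain ⟨rep', hr1, hr2, hr3⟩ := hz
  rw [hr2] at hr3
  refine hi m (d ∘ g) (fun t => ⟨_, rfl⟩) φ hinv (fun r t => rep' ⟨r, t⟩) ((hΓ _).1 hr1) hr3
    ⟨kk, D', hkk, hr2, ?_, ?_⟩
  · intro n i j hi hj ψ hψ c hc
    have hfd : FD L (fun w : (((ℕ × (Fin m ⊕ ImVars e)) ⊕ (ι ⊕ κ)) ⊕ ImVars e) → M =>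
        ψ.Realize (w ∘ Sum.map (fun p : Fin n × (Fin m ⊕ ImVars e) => Sum.inl (i p.1, p.2)) id) ↔
        ψ.Realize (w ∘ Sum.map (fun p : Fin n × (Fin m ⊕ ImVars e) => Sum.inl (j p.1, p.2)) id)) :=
      ((FD.of ψ).comp _).iff ((FD.of ψ).comp _)
    obtain ⟨z, hz1, hz2⟩ := hG.inv hfd ⟨Γ.c, Γ.refl _, by
      simp only [Sum.elim_comp_map, Function.comp_id]
      exact hD n i j hi hj ψ hψ _ ((hΓ Γ.c).1 (Γ.refl _))⟩
    simp only [Sum.elim_comp_map, Function.comp_id] at hz2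
    have h1 := hψ (fun p => D' (i p.1) p.2) _ _ hc ((hΓ z).1 hz1)
    have h2 := hψ (fun p => D' (j p.1) p.2) _ _ hc ((hΓ z).1 hz1)
    exact h1.trans (Iff.trans hz2 h2.symm)
  · intro s hs hex
    have hfd : FD L (fun w : ((ℕ × (Fin m ⊕ ImVars e)) ⊕ (ι ⊕ κ)) → M =>
        ∃ x : ι → M, ∀ i ∈ s, φ.Realize (Sum.elim x (w ∘ fun t => Sum.inl (i, t)))) := by
      refine FD.ex (S := fun w : ι ⊕ ((ℕ × (Fin m ⊕ ImVars e)) ⊕ (ι ⊕ κ)) → M =>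
        ∀ i ∈ s, φ.Realize (Sum.elim (w ∘ Sum.inl) (w ∘ fun t => Sum.inr (Sum.inl (i, t))))) ?_
      refine FD.forall_finset s fun i _ => ?_
      refine ((FD.of φ).comp (Sum.elim Sum.inl fun t => Sum.inr (Sum.inl (i, t)))).congr
        fun w => iff_of_eq (congrArg _ ?_)
      funext t
      rcases t with t | t <;> rfl
    exact hinc s hs (hG.same.symm _ hfd hex)

theorem indep_of_mini (hΓ : ∀ z : ImVars e → M, Γ.Er Γ.c z ↔ IsRep e (fun r t => z ⟨r, t⟩))
    [Countable X] [Finite ι] [Finite κ] {F : Filter (X → M)} (hF : Γ.Mini F)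
    {P : Ultrafilter (X → M)} (hP : (P : Filter (X → M)) ≤ F) (v : ι → X) (d : κ → M)
    {y : ι → M} (hy : Rz L (P.map (fun x => x ∘ v)) y (Sum.elim d Γ.c)) :
    IndepOverIm (L := L) y (range d) e := by
  intro m c hc φ hinv rep hrep hφ hdiv
  obtain ⟨g, rfl⟩ := mem_range_fun hc
  obtain ⟨kk, D, hkk, hD0, hD, hinc⟩ := hdiv
  have hc' := (hΓ Γ.c).1 (Γ.refl _)
  have h1 : φ.Realize (Sum.elim y (Sum.elim (d ∘ g) Γ.c)) := (hinv _ _ _ _ hrep hc').1 hφ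
  have h2 := ((hy.comp (Sum.map g id)).iff (S := fun w => φ.Realize w) (FD.of φ))
  rw [Sum.elim_comp_map, Function.comp_id] at h2
  have h3 := h2.1 h1
  have h4 : ∀ᶠ x in (P : Filter (X → M)),
      φ.Realize (Sum.elim (x ∘ v) (Sum.elim (d ∘ g) Γ.c)) := h3
  have h5 : ∀ᶠ x in (P : Filter (X → M)), φ.Realize (Sum.elim (x ∘ v) (D 0)) := by
    filter_upwards [h4] with x hx
    rw [hD0]
    exact (hinv _ _ _ _ hc' hrep).1 hx
  have hmono : ∀ n : ℕ, StrictMono (fun _ : Fin 1 => n) := fun n => Subsingleton.strictMono _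
  have h6 : ∀ n, ∀ᶠ x in (P : Filter (X → M)), φ.Realize (Sum.elim (x ∘ v) (D n)) := by
    intro n
    have hl := lascar hF hP (ind_of_im hΓ hD) (hmono 0) (hmono n)
      ((FD.of φ).comp (Sum.map v (fun t => ((0 : Fin 1), t))))
    simp only [Sum.elim_comp_map] at hl
    exact hl.1 h5
  have h7 : ∀ᶠ x in (P : Filter (X → M)), ∀ n ∈ Finset.range kk,
      φ.Realize (Sum.elim (x ∘ v) (D n)) := (Filter.eventually_all_finset _).2 fun n _ => h6 n
  obtain ⟨x, hx⟩ := h7.exists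
  exact hinc (Finset.range kk) (by simp) ⟨_, hx⟩

theorem ec_of_sameType
    (hΓ : ∀ z : ImVars e → M, Γ.Er Γ.c z ↔ IsRep e (fun r t => z ⟨r, t⟩))
    [Finite ι] [Finite κ] {a a' : ι → M} {d : κ → M}
    (h : SameTypeOverIm (L := L) a a' (range d) e) :
    Γ.EC (Sum.elim a d) (Sum.elim a' d) := by
  refine Ctx.EC.of_inv fun S hS hd => ?_
  obtain ⟨m, ⟨σ⟩⟩ := Finite.exists_equiv_fin κ
  obtain ⟨ψ, hψ⟩ := (Γ.fd_hat hS).comp (Sum.elim (Sum.map id (fun t => Sum.inl (σ t)))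
    (fun t => Sum.inr (Sum.inr t)) : (ι ⊕ κ) ⊕ ImVars e → ι ⊕ (Fin m ⊕ ImVars e))
  have he : ∀ (x : ι → M) (c0 : Fin m → M) (z : ImVars e → M),
      ψ.Realize (Sum.elim x (Sum.elim c0 z)) ↔ Γ.hat S (Sum.elim (Sum.elim x (c0 ∘ σ)) z) := by
    intro x c0 z
    rw [← hψ]
    refine iff_of_eq (congrArg _ ?_)
    funext t
    rcases t with (t | t) | t <;> rfl
  have h1 := h m (d ∘ σ.symm) (fun t => ⟨_, rfl⟩) ψ (by
    intro x c0 r1 r2 hr1 hr2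
    rw [he, he]
    have := Γ.trans (Γ.symm (er_of_rep hΓ hr1)) (er_of_rep hΓ hr2)
    exact ⟨hat_saturated _ this, hat_saturated _ (Γ.symm this)⟩) _ ((hΓ Γ.c).1 (Γ.refl _))
  rw [he, he] at h1
  have hσ : (d ∘ σ.symm) ∘ σ = d := by
    funext t
    simp
  rw [hσ] at h1
  exact h1.1 ⟨Γ.c, Γ.refl _, hd⟩

end Inst

section Final

variable {M : Type w} [L.Structure M] [Nonempty M] {k : ℕ} {e : Fin k → Im L M}
variable {Γ : Ctx L M (ImVars e)}

/-- Regrouping of variables in the tensor product. -/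
def regroup (α₁ β₁ α₂ β₂ : Type*) : (α₁ ⊕ α₂) ⊕ (β₁ ⊕ β₂) → (α₁ ⊕ β₁) ⊕ (α₂ ⊕ β₂) :=
  Sum.elim (Sum.map Sum.inl Sum.inl) (Sum.map Sum.inr Sum.inr)

theorem tensor_type (hΓ : ∀ z : ImVars e → M, Γ.Er Γ.c z ↔ IsRep e (fun r t => z ⟨r, t⟩))
    {X α₁ β₁ α₂ β₂ : Type*} [Countable X] [Finite α₁] [Finite β₁] [Finite α₂] [Finite β₂]
    {a0 : X → M} {F : Filter (X → M)} (hF : Γ.Mini F) (hF0 : F ≤ Γ.F0 a0)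
    {P : Ultrafilter (X → M)} (hP : (P : Filter (X → M)) ≤ F)
    (v : α₁ ⊕ β₁ → X) (d : α₂ ⊕ β₂ → M)
    {p₁ : Set (L.Formula ((α₁ ⊕ β₁) ⊕ ImVars e))} {p₂ : Set (L.Formula ((α₂ ⊕ β₂) ⊕ ImVars e))}
    (hp₁ : IsStationaryOverIm (L := L) e p₁)
    (h1 : typeOverIm (L := L) e (a0 ∘ v) = p₁) (h2 : typeOverIm (L := L) e d = p₂)
    {r : Set (L.Formula (((α₁ ⊕ α₂) ⊕ (β₁ ⊕ β₂)) ⊕ ImVars e))} (hr : IsTensor (L := L) e p₁ p₂ r)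
    {y : α₁ ⊕ β₁ → M} (hy : Rz L (P.map (fun x => x ∘ v)) y (Sum.elim d Γ.c)) :
    typeOverIm (L := L) e (Sum.elim y d ∘ regroup α₁ β₁ α₂ β₂) = r := by
  obtain ⟨a₁, b₁, a₂, b₂, ht1, ht2, hind, rfl⟩ := hr
  have hec := ec_of_type hΓ (ht2.trans h2.symm)
  obtain ⟨y', hy'⟩ := hec.ext (Sum.elim a₁ b₁)
  have hr : range a₂ ∪ range b₂ = range (Sum.elim a₂ b₂) := by
    rw [Set.Sum.elim_range]
  rw [hr] at hind
  have hind' := indep_ec hΓ hy' hind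
  have hty' : typeOverIm (L := L) e y' = p₁ := by
    rw [← ht1]
    exact (type_eq hΓ (hy'.comp Sum.inl)).symm
  have hty : typeOverIm (L := L) e y = p₁ := by
    rw [← h1]
    refine (type_eq hΓ (Ctx.EC.of_inv fun S hS ha => ?_)).symm
    refine (hy.comp Sum.inr) _ (Γ.fd_hat hS) ?_
    have := (hP.trans hF0) (Ctx.F0_mem (Γ := Γ) (a := a0) (hS.comp (Sum.map v id)) (by
      rw [Sum.elim_comp_map]
      exact ha))
    change ∀ᶠ x in (P : Filter (X → M)), Γ.hat S (Sum.elim (x ∘ v) Γ.c)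
    filter_upwards [this] with x hx
    obtain ⟨z, hz1, hz2⟩ := hx
    rw [Sum.elim_comp_map] at hz2
    exact ⟨z, hz1, hz2⟩
  have hst := hp₁ y y' hty hty' (range d) (indep_of_mini hΓ hF hP v d hy) hind'
  have hE := (ec_of_sameType (Γ := Γ) hΓ hst).trans hy'.symm
  rw [type_eq hΓ (hE.comp (regroup α₁ β₁ α₂ β₂))]
  congr 1
  funext t
  rcases t with (t | t) | (t | t) <;> rfl

theorem pf_main (hΓ : ∀ z : ImVars e → M, Γ.Er Γ.c z ↔ IsRep e (fun r t => z ⟨r, t⟩))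
    {α₁ β₁ α₂ β₂ : Type*} [Finite α₁] [Finite β₁] [Finite α₂] [Finite β₂]
    (p₁ q₁ : Set (L.Formula ((α₁ ⊕ β₁) ⊕ ImVars e)))
    (p₂ q₂ : Set (L.Formula ((α₂ ⊕ β₂) ⊕ ImVars e)))
    (hp₁ : IsStationaryOverIm (L := L) e p₁) (hq₁ : IsStationaryOverIm (L := L) e q₁)
    (h₁ : PfOverIm (L := L) (α := α₁) (β := β₁) e p₁ q₁)
    (h₂ : PfOverIm (L := L) (α := α₂) (β := β₂) e p₂ q₂)
    (r₁ r₂ : Set (L.Formula (((α₁ ⊕ α₂) ⊕ (β₁ ⊕ β₂)) ⊕ ImVars e)))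
    (hr₁ : IsTensor (L := L) e p₁ p₂ r₁) (hr₂ : IsTensor (L := L) e q₁ q₂ r₂) :
    PfOverIm (L := L) (α := α₁ ⊕ α₂) (β := β₁ ⊕ β₂) e r₁ r₂ := by
  obtain ⟨b1, A1, hA1, h1p, h1q⟩ := h₁
  obtain ⟨b2, A2, hA2, h2p, h2q⟩ := h₂
  let a0 : (ℕ × α₁) ⊕ β₁ → M := Sum.elim (fun p => A1 p.1 p.2) b1
  let c0 : (ℕ × α₂) ⊕ β₂ → M := Sum.elim (fun p => A2 p.1 p.2) b2
  obtain ⟨F, hF0, hF⟩ := Ctx.exists_mini (Γ.F0_good a0)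
  have hFne := hF.1.ne
  let P : Ultrafilter ((ℕ × α₁) ⊕ β₁ → M) := Ultrafilter.of F
  have hP : (P : Filter ((ℕ × α₁) ⊕ β₁ → M)) ≤ F := Ultrafilter.of_le F
  obtain ⟨W, hW⟩ := exists_rz Γ.hO (P.map (fun x => Sum.elim x c0)) Γ.c
  have hW' : ∀ S : ((((ℕ × α₁) ⊕ β₁) ⊕ ((ℕ × α₂) ⊕ β₂)) ⊕ ImVars e → M) → Prop, FD L S →
      (S (Sum.elim W Γ.c) ↔ ∀ᶠ x in (P : Filter ((ℕ × α₁) ⊕ β₁ → M)),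
        S (Sum.elim (Sum.elim x c0) Γ.c)) := fun S hS => hW.iff hS
  let v : ℕ → α₁ ⊕ β₁ → (ℕ × α₁) ⊕ β₁ := fun n => Sum.map (fun t => (n, t)) id
  let v' : ℕ → α₂ ⊕ β₂ → (ℕ × α₂) ⊕ β₂ := fun n => Sum.map (fun t => (n, t)) id
  let out : ℕ → α₁ ⊕ α₂ → M := fun n => Sum.elim (fun t => W (Sum.inl (Sum.inl (n, t))))
    (fun t => W (Sum.inr (Sum.inl (n, t))))
  let bout : β₁ ⊕ β₂ → M := Sum.elim (fun t => W (Sum.inl (Sum.inr t)))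
    (fun t => W (Sum.inr (Sum.inr t)))
  have key : ∀ n, ∃ y : α₁ ⊕ β₁ → M,
      Rz L (P.map (fun x => x ∘ v n)) y (Sum.elim (Sum.elim (A2 n) b2) Γ.c) ∧
      typeOverIm (L := L) e (Sum.elim (out n) bout) =
        typeOverIm (L := L) e (Sum.elim y (Sum.elim (A2 n) b2) ∘ regroup α₁ β₁ α₂ β₂) := by
    intro n
    obtain ⟨y, hy⟩ := exists_rz Γ.hO (P.map (fun x => x ∘ v n)) (Sum.elim (Sum.elim (A2 n) b2) Γ.c)
    refine ⟨y, hy, type_eq hΓ (Γ := Γ) ⟨Γ.c, Γ.c, Γ.refl _, Γ.refl _, ?_⟩⟩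
    intro S hS hWS
    have h3 := (hW' _ (hS.comp (Sum.map (Sum.map (v n) (v' n) ∘ regroup α₁ β₁ α₂ β₂) id))).1 (by
      convert hWS using 1
      funext t
      rcases t with ((t | t) | (t | t)) | t <;> rfl)
    have h4 := hy _ (hS.comp (Sum.elim
      ((Sum.map id Sum.inl : (α₁ ⊕ β₁) ⊕ (α₂ ⊕ β₂) → (α₁ ⊕ β₁) ⊕ ((α₂ ⊕ β₂) ⊕ ImVars e)) ∘
        regroup α₁ β₁ α₂ β₂) (fun t => Sum.inr (Sum.inr t)))) (by
      change ∀ᶠ x in (P : Filter ((ℕ × α₁) ⊕ β₁ → M)), S _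
      filter_upwards [h3] with x hx
      convert hx using 1
      funext t
      rcases t with ((t | t) | (t | t)) | t <;> rfl)
    convert h4 using 1
    funext t
    rcases t with ((t | t) | (t | t)) | t <;> rfl
  have hv : ∀ n, a0 ∘ v n = Sum.elim (A1 n) b1 := by
    intro n
    funext t
    rcases t with t | t <;> rfl
  refine ⟨bout, out, ind_of_same fun n i j hi hj => ?_, fun n hn => ?_, ?_⟩
  · intro S hS hSi
    let G : (Fin n → ℕ) → Fin n × (α₁ ⊕ α₂) → ((ℕ × α₁) ⊕ β₁) ⊕ ((ℕ × α₂) ⊕ β₂) := fun i p =>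
      Sum.elim (fun t => Sum.inl (Sum.inl (i p.1, t))) (fun t => Sum.inr (Sum.inl (i p.1, t))) p.2
    have hG : ∀ i, blk out i = W ∘ G i := by
      intro i
      funext p
      obtain ⟨p, t | t⟩ := p <;> rfl
    let ρ : Fin n × (α₁ ⊕ α₂) → (Fin n × α₁) ⊕ (Fin n × α₂) := fun p =>
      Sum.elim (fun t => Sum.inl (p.1, t)) (fun t => Sum.inr (p.1, t)) p.2
    have hρ : ∀ i x, Sum.elim x c0 ∘ G i = Sum.elim (blk (sq x) i) (blk A2 i) ∘ ρ := by
      intro i x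
      funext p
      obtain ⟨p, t | t⟩ := p <;> rfl
    have hWi : ∀ i, S (blk out i) ↔ ∀ᶠ x in (P : Filter ((ℕ × α₁) ⊕ β₁ → M)),
        S (Sum.elim (blk (sq x) i) (blk A2 i) ∘ ρ) := by
      intro i
      have := hW' _ (hS.comp (Sum.inl ∘ G i))
      rw [hG]
      simp only [← hρ]
      exact this
    rw [hWi] at hSi ⊢
    have hl := lascar hF hP hA2 hi hj ((hS.comp ρ).comp (Sum.map (bix α₁ β₁ i) id))
    simp only [Sum.elim_comp_map, comp_bix, Function.comp_id] at hl
    exact lemD (a0 := a0) hA1 hF hF0 hP hi hj (hS.comp ρ) _ (hl.1 hSi)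
  · obtain ⟨y, hy, ht⟩ := key n
    rw [ht]
    exact tensor_type hΓ hF hF0 hP (v n) _ hp₁ (by rw [hv]; exact h1p n hn) (h2p n hn) hr₁ hy
  · obtain ⟨y, hy, ht⟩ := key 0
    rw [ht]
    exact tensor_type hΓ hF hF0 hP (v 0) _ hq₁ (by rw [hv]; exact h1q) h2q hr₂ hy

theorem stb_of_stable (hst : IsStable T) (M : Theory.ModelType.{u, v, max u v} T) : Stb L M := by
  rintro n m S ⟨φ, hφ⟩ a b h
  refine hst n m φ M a b fun i j => ?_
  rw [← hφ]
  exact h i j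

end Final

/-- In a stable theory, working inside a monster model: if `c` is a tuple of
imaginary elements algebraic over `∅` and `pʲ(xʲ; yʲ, c) ⟶ qʲ(xʲ; yʲ, c)` for `j = 1, 2`,
where all four types are stationary, then
`p¹(x¹; y¹, c) ⊗ p²(x²; y², c) ⟶ q¹(x¹; y¹, c) ⊗ q²(x²; y², c)`. -/
theorem pf_tensor (hT : T.IsComplete) (hst : IsStable T)
    (M : Theory.ModelType.{u, v, max u v} T) (hM : IsMonster (L := L) M)
    {k : ℕ} (e : Fin k → Im L M) (he : ∀ r, InAclEq (L := L) (∅ : Set ↥M) (e r))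
    {α₁ β₁ α₂ β₂ : Type (max u v)} [Finite α₁] [Finite β₁] [Finite α₂] [Finite β₂]
    (p₁ q₁ : Set (L.Formula ((α₁ ⊕ β₁) ⊕ ImVars e)))
    (p₂ q₂ : Set (L.Formula ((α₂ ⊕ β₂) ⊕ ImVars e)))
    (hp₁ : IsStationaryOverIm (L := L) e p₁) (hq₁ : IsStationaryOverIm (L := L) e q₁)
    (hp₂ : IsStationaryOverIm (L := L) e p₂) (hq₂ : IsStationaryOverIm (L := L) e q₂)
    (h₁ : PfOverIm (L := L) (α := α₁) (β := β₁) e p₁ q₁)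
    (h₂ : PfOverIm (L := L) (α := α₂) (β := β₂) e p₂ q₂)
    (r₁ r₂ : Set (L.Formula (((α₁ ⊕ α₂) ⊕ (β₁ ⊕ β₂)) ⊕ ImVars e)))
    (hr₁ : IsTensor (L := L) e p₁ p₂ r₁) (hr₂ : IsTensor (L := L) e q₁ q₂ r₂) :
    PfOverIm (L := L) (α := α₁ ⊕ α₂) (β := β₁ ⊕ β₂) e r₁ r₂ := by
  have : Nonempty M := inferInstance
  obtain ⟨Γ, hΓ⟩ := exists_ctx (osat_of_monster hM) (stb_of_stable T hst M) e he
  exact pf_main hΓ p₁ q₁ p₂ q₂ hp₁ hq₁ h₁ h₂ r₁ r₂ hr₁ hr₂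

end Equationality
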